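/- For every real ε > 0 there exists an integer N such that for every integer n ≥ N: (a) every twin-free K_3-saturated graph on n vertices has at least (17/3 - ε)·n edges, and (b) there exists a twin-free K_3-saturated graph on n vertices with at most (6+ε)·n edges. -/

import Mathlib

open SimpleGraph

/-- `G` is `K_r`-saturated: `G` contains no `r`-clique, but adding any missing edge
creates an `r`-clique. -/
def Ksat (r : ℕ) {V : Type*} (G : SimpleGraph V) : Prop :=
  G.CliqueFree r ∧ ∀ u v : V, u ≠ v → ¬ G.Adj u v →
    ¬ (G ⊔ fromEdgeSet {s(u, v)}).CliqueFree r

/-- `G` is twin-free: distinct vertices have distinct neighbourhoods. -/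
def TwinFree {V : Type*} (G : SimpleGraph V) : Prop :=
  ∀ u v : V, G.neighborSet u = G.neighborSet v → u = v

/-- Minimum degree of `G` is at least `t`. -/
def MinDegGe {V : Type*} (G : SimpleGraph V) (t : ℕ) : Prop :=
  ∀ v : V, t ≤ (G.neighborSet v).ncard

/-- Every pair of distinct twins has a common neighbour of degree exactly `t`. -/
def TwinCond {V : Type*} (G : SimpleGraph V) (t : ℕ) : Prop :=
  ∀ u v : V, u ≠ v → G.neighborSet u = G.neighborSet v →
    ∃ w : V, (G.neighborSet w).ncard = t ∧ G.Adj w u ∧ G.Adj w v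

/-- An `(r,t)`-system. -/
def IsRTSystem (r t : ℕ) {V : Type*} [DecidableEq V] (H : SimpleGraph V)
    (F : Finset (Finset V)) : Prop :=
  H.CliqueFree r ∧
  (∀ S ∈ F, S.card = t ∧
    (H.induce (S : Set V)).CliqueFree (r - 1) ∧
    ∀ v : V, v ∉ S → ¬ (H.induce ((insert v S : Finset V) : Set V)).CliqueFree (r - 1)) ∧
  (∀ S ∈ F, ∀ T ∈ F, S ≠ T → ¬ (H.induce ((S ∩ T : Finset V) : Set V)).CliqueFree (r - 2))

/-- A maximal `(r,t)`-system. -/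
def IsMaxRTSystem (r t : ℕ) {V : Type*} [DecidableEq V] (H : SimpleGraph V)
    (F : Finset (Finset V)) : Prop :=
  IsRTSystem r t H F ∧
  ∀ u v : V, u ≠ v → ¬ H.Adj u v →
    ¬ (H ⊔ fromEdgeSet {s(u, v)}).CliqueFree r ∨
    ∃ S ∈ F, ¬ (((H ⊔ fromEdgeSet {s(u, v)}).induce (S : Set V)).CliqueFree (r - 1))

/-- A `(3,t)`-system. -/
def Is3TSystem (t : ℕ) {V : Type*} [DecidableEq V] (H : SimpleGraph V)
    (F : Finset (Finset V)) : Prop :=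
  H.CliqueFree 3 ∧
  (∀ S ∈ F, S.card = t ∧
    (∀ u ∈ S, ∀ v ∈ S, ¬ H.Adj u v) ∧
    (∀ v : V, v ∉ S → ∃ u ∈ S, H.Adj v u)) ∧
  (∀ S ∈ F, ∀ T ∈ F, S ≠ T → (S ∩ T).Nonempty)

/-- A maximal `(3,t)`-system. -/
def IsMax3TSystem (t : ℕ) {V : Type*} [DecidableEq V] (H : SimpleGraph V)
    (F : Finset (Finset V)) : Prop :=
  Is3TSystem t H F ∧
  ∀ u v : V, u ≠ v → ¬ H.Adj u v →
    ¬ (H ⊔ fromEdgeSet {s(u, v)}).CliqueFree 3 ∨ ∃ S ∈ F, u ∈ S ∧ v ∈ S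

noncomputable def s3 (t m : ℕ) : ℕ :=
  sSup {a : ℕ | ∃ (H : SimpleGraph (Fin m)) (F : Finset (Finset (Fin m))),
    Is3TSystem t H F ∧ F.card = a}

noncomputable def ePrime (r t s : ℕ) : ℕ :=
  sInf {e : ℕ | ∃ (m : ℕ) (H : SimpleGraph (Fin m)) (F : Finset (Finset (Fin m))),
    IsMaxRTSystem r t H F ∧ F.card = s ∧ H.edgeSet.ncard = e}

noncomputable def e3min (t s : ℕ) : ℕ :=
  sInf {e : ℕ | ∃ (m : ℕ) (H : SimpleGraph (Fin m)) (F : Finset (Finset (Fin m))),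
    Is3TSystem t H F ∧ F.card = s ∧ H.edgeSet.ncard = e}

namespace TwinFreeSat

section LowerBound

open Finset
open scoped Classical

variable {V : Type*} {G : SimpleGraph V}

/-- `G` has no triangle, in the form used throughout. -/
def NoTriangle (G : SimpleGraph V) : Prop :=
  ∀ ⦃a b c : V⦄, G.Adj a b → G.Adj b c → ¬ G.Adj a c

/-- `x, y, z` are pairwise non-adjacent vertices of `U` that together dominate all but at most `c`
vertices of `U` (themselves counted among the undominated ones). -/
def AlmostDom (G : SimpleGraph V) (U : Finset V) (c : ℕ) (x y z : V) : Prop :=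
  x ∈ U ∧ y ∈ U ∧ z ∈ U ∧ ¬ G.Adj x y ∧ ¬ G.Adj x z ∧ ¬ G.Adj y z ∧
    #{u ∈ U | ¬ G.Adj x u ∧ ¬ G.Adj y u ∧ ¬ G.Adj z u} ≤ c

lemma AlmostDom.swap12 {U : Finset V} {c : ℕ} {x y z : V} (h : AlmostDom G U c x y z) :
    AlmostDom G U c y x z := by
  obtain ⟨hx, hy, hz, hxy, hxz, hyz, hc⟩ := h
  refine ⟨hy, hx, hz, fun h => hxy h.symm, hyz, hxz, le_trans (card_le_card ?_) hc⟩
  intro u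
  simp only [mem_filter]
  tauto

lemma AlmostDom.swap23 {U : Finset V} {c : ℕ} {x y z : V} (h : AlmostDom G U c x y z) :
    AlmostDom G U c x z y := by
  obtain ⟨hx, hy, hz, hxy, hxz, hyz, hc⟩ := h
  refine ⟨hx, hz, hy, hxz, hxy, fun h => hyz h.symm, le_trans (card_le_card ?_) hc⟩
  intro u
  simp only [mem_filter]
  tauto

lemma card_filter_card_nonNbr_le (ht : NoTriangle G) (U : Finset V) (c : ℕ) :
    #{z ∈ U | #{u ∈ U | ¬ G.Adj z u} ≤ c} ≤ 2 * c := by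
  set Z := {z ∈ U | #{u ∈ U | ¬ G.Adj z u} ≤ c} with hZ
  rcases Z.eq_empty_or_nonempty with h | ⟨z, hz⟩
  · simp [h]
  have hzc : #{u ∈ U | ¬ G.Adj z u} ≤ c := by
    rw [hZ, mem_filter] at hz; exact hz.2
  have hsub : Z ⊆ U := filter_subset _ _
  rcases (Z.filter fun u => G.Adj z u).eq_empty_or_nonempty with h | ⟨w, hw⟩
  · have : Z ⊆ {u ∈ U | ¬ G.Adj z u} := by
      intro u hu
      rw [mem_filter]
      refine ⟨hsub hu, fun hadj => ?_⟩
      have : u ∈ Z.filter fun u => G.Adj z u := by simp [hu, hadj]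
      rw [h] at this
      simp at this
    have := card_le_card this
    omega
  · rw [mem_filter] at hw
    have hwc : #{u ∈ U | ¬ G.Adj w u} ≤ c := by
      have := hw.1
      rw [hZ, mem_filter] at this; exact this.2
    have : Z ⊆ {u ∈ U | ¬ G.Adj z u} ∪ {u ∈ U | ¬ G.Adj w u} := by
      intro u hu
      simp only [mem_union, mem_filter]
      by_cases h1 : G.Adj z u
      · right
        exact ⟨hsub hu, fun h2 => ht hw.2 h2 h1⟩
      · left
        exact ⟨hsub hu, h1⟩
    have h1 := card_le_card this
    have h2 := card_union_le {u ∈ U | ¬ G.Adj z u} {u ∈ U | ¬ G.Adj w u}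
    omega

lemma card_filter_almostDom_le (ht : NoTriangle G) (U : Finset V) (c : ℕ) (x y : V) :
    #{z ∈ U | AlmostDom G U c x y z} ≤ 2 * c := by
  refine le_trans (card_le_card ?_)
    (card_filter_card_nonNbr_le ht {u ∈ U | ¬ G.Adj x u ∧ ¬ G.Adj y u} c)
  intro z hz
  obtain ⟨-, hx, hy, hz', hxy, hxz, hyz, hc⟩ := mem_filter.1 hz
  rw [mem_filter, mem_filter, filter_filter]
  refine ⟨⟨hz', hxz, hyz⟩, ?_⟩
  simpa only [and_assoc] using hc

/-- The pairs completing `x` to an almost dominating triple. -/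
noncomputable def linkPairs (G : SimpleGraph V) (U : Finset V) (c : ℕ) (x : V) : Finset (V × V) :=
  {p ∈ U ×ˢ U | AlmostDom G U c x p.1 p.2}

lemma mem_linkPairs {U : Finset V} {c : ℕ} {x : V} {p : V × V} :
    p ∈ linkPairs G U c x ↔ AlmostDom G U c x p.1 p.2 := by
  simp only [linkPairs, mem_filter, mem_product, and_iff_right_iff_imp]
  exact fun h => ⟨h.2.1, h.2.2.1⟩

lemma card_linkPairs_fst (ht : NoTriangle G) (U F : Finset V) (c : ℕ) (x : V) :
    #{p ∈ linkPairs G U c x | p.1 ∈ F} ≤ 2 * c * #F := by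
  refine card_le_mul_card_image_of_maps_to (f := Prod.fst) (by simp) _ ?_
  intro a _
  refine le_trans (card_le_card_of_injOn Prod.snd ?_ ?_) (card_filter_almostDom_le ht U c x a)
  · rintro ⟨p, q⟩ hp
    simp only [coe_filter, mem_filter, Set.mem_ofPred_eq, mem_linkPairs] at hp ⊢
    obtain ⟨⟨h1, -⟩, rfl⟩ := hp
    exact ⟨h1.2.2.1, h1⟩
  · rintro ⟨p, q⟩ hp ⟨p', q'⟩ hp' h
    simp only [coe_filter, mem_filter, Set.mem_ofPred_eq] at hp hp' h
    rw [Prod.mk.injEq]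
    exact ⟨hp.2.trans hp'.2.symm, h⟩

lemma card_linkPairs_snd (ht : NoTriangle G) (U F : Finset V) (c : ℕ) (x : V) :
    #{p ∈ linkPairs G U c x | p.2 ∈ F} ≤ 2 * c * #F := by
  refine le_trans (card_le_card_of_injOn Prod.swap ?_ Prod.swap_injective.injOn)
    (card_linkPairs_fst ht U F c x)
  rintro ⟨p, q⟩ hp
  simp only [coe_filter, Set.mem_ofPred_eq, mem_linkPairs, Prod.swap] at hp ⊢
  exact ⟨hp.1.swap23, hp.2⟩

/-- The pairs `(y', z')` in the link of `x` joined crosswise to `(y, z)`. -/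
noncomputable def crossPairs (G : SimpleGraph V) (U : Finset V) (c : ℕ) (x y z : V) :
    Finset (V × V) :=
  {p ∈ linkPairs G U c x | G.Adj p.1 z ∧ G.Adj p.2 y ∧ ¬ G.Adj p.1 y ∧ ¬ G.Adj p.2 z}

lemma card_linkPairs_common (ht : NoTriangle G) (U : Finset V) (c : ℕ) (x y : V) :
    #{p ∈ linkPairs G U c x | G.Adj p.1 y ∧ G.Adj p.2 y} ≤ 2 * c * c := by
  set P := {p ∈ linkPairs G U c x | G.Adj p.1 y ∧ G.Adj p.2 y} with hP
  rcases P.eq_empty_or_nonempty with h | ⟨⟨a, b⟩, hp⟩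
  · simp [h]
  rw [hP, mem_filter, mem_linkPairs] at hp
  obtain ⟨h, ha, hb⟩ := hp
  simp only at h ha hb
  set F := {u ∈ U | ¬ G.Adj x u ∧ ¬ G.Adj a u ∧ ¬ G.Adj b u} with hF
  have hFc : #F ≤ c := h.2.2.2.2.2.2
  refine le_trans (card_le_card ?_) ((card_linkPairs_fst ht U F c x).trans
    (Nat.mul_le_mul_left _ hFc))
  intro p hp
  rw [hP, mem_filter] at hp
  rw [mem_filter]
  refine ⟨hp.1, ?_⟩
  have h2 := mem_linkPairs.1 hp.1
  rw [hF, mem_filter]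
  exact ⟨h2.2.1, h2.2.2.2.1, fun h3 => ht h3 hp.2.1 ha, fun h3 => ht h3 hp.2.1 hb⟩

lemma card_linkPairs_le (ht : NoTriangle G) {U : Finset V} {c : ℕ} {x y z : V}
    (h : AlmostDom G U c x y z) :
    #(linkPairs G U c x) ≤ 8 * c * c + 2 * #(crossPairs G U c x y z) := by
  set F := {u ∈ U | ¬ G.Adj x u ∧ ¬ G.Adj y u ∧ ¬ G.Adj z u} with hF
  have hFc : #F ≤ c := h.2.2.2.2.2.2
  have hsub : linkPairs G U c x ⊆
      ({p ∈ linkPairs G U c x | p.1 ∈ F} ∪ {p ∈ linkPairs G U c x | p.2 ∈ F}) ∪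
      ({p ∈ linkPairs G U c x | G.Adj p.1 y ∧ G.Adj p.2 y} ∪
       {p ∈ linkPairs G U c x | G.Adj p.1 z ∧ G.Adj p.2 z}) ∪
      (crossPairs G U c x y z ∪ (crossPairs G U c x y z).image Prod.swap) := by
    rintro ⟨a, b⟩ hp
    have h2 := mem_linkPairs.1 hp
    have h3 := h2.swap23
    simp only at h2 h3
    have hx1 := h2.2.2.2.1
    have hx2 := h2.2.2.2.2.1
    have e : (a, b) ∈ (crossPairs G U c x y z).image Prod.swap ↔
        (b, a) ∈ crossPairs G U c x y z := by
      constructor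
      · rintro h
        obtain ⟨⟨p, q⟩, h, h'⟩ := mem_image.1 h
        simp only [Prod.swap, Prod.mk.injEq] at h'
        rw [← h'.1, ← h'.2]; exact h
      · intro h
        exact mem_image.2 ⟨_, h, rfl⟩
    simp only [mem_union, e]
    simp only [mem_filter, crossPairs, mem_linkPairs, h2, h3, hF, h2.2.1, h2.2.2.1, true_and]
    by_cases s1 : G.Adj y a <;> by_cases s2 : G.Adj z a <;> by_cases s3 : G.Adj y b <;>
      by_cases s4 : G.Adj z b <;>
      simp [hx1, hx2, s1, s2, s3, s4, G.adj_comm a y, G.adj_comm a z, G.adj_comm b y,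
        G.adj_comm b z]
  have h1 := card_le_card hsub
  have a6 : 2 * c * #F ≤ 2 * c * c := Nat.mul_le_mul_left _ hFc
  have a1 := (card_linkPairs_fst ht U F c x).trans a6
  have a2 := (card_linkPairs_snd ht U F c x).trans a6
  have a3 := card_linkPairs_common ht U c x y
  have a4 := card_linkPairs_common ht U c x z
  have a5 := card_image_le (s := crossPairs G U c x y z) (f := Prod.swap)
  refine h1.trans ((card_union_le _ _).trans ((add_le_add ((card_union_le _ _).trans
    (add_le_add ((card_union_le _ _).trans (add_le_add a1 a2))
      ((card_union_le _ _).trans (add_le_add a3 a4)))) ((card_union_le _ _).trans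
        (add_le_add le_rfl a5))).trans (le_of_eq ?_)))
  ring

/-- Three large sets with pairwise relations that fail only a bounded number of times at each
element contain a cyclically related triple. -/
lemma exists_cyclic_triple {α β γ : Type*} (A : Finset α) (B : Finset β) (C : Finset γ)
    (r : α → β → Prop) (s : β → γ → Prop) (t : γ → α → Prop) (R : ℕ)
    (hr : ∀ a ∈ A, #{b ∈ B | ¬ r a b} ≤ R) (hs : ∀ b ∈ B, #{c ∈ C | ¬ s b c} ≤ R)
    (htt : ∀ c ∈ C, #{a ∈ A | ¬ t c a} ≤ R) (hA : 3 * R < #A) (hB : 3 * R < #B) (hC : 3 * R < #C) :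
    ∃ a ∈ A, ∃ b ∈ B, ∃ c ∈ C, r a b ∧ s b c ∧ t c a := by
  by_contra! hcon
  have key : #(A ×ˢ B ×ˢ C) ≤ #A * R * #C + #A * (#B * R) + R * #B * #C := by
    have h1 : A ×ˢ B ×ˢ C ⊆ ({p ∈ A ×ˢ B ×ˢ C | ¬ r p.1 p.2.1} ∪
        {p ∈ A ×ˢ B ×ˢ C | ¬ s p.2.1 p.2.2}) ∪ {p ∈ A ×ˢ B ×ˢ C | ¬ t p.2.2 p.1} := by
      rintro ⟨a, b, c⟩ hp
      have hp' := hp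
      simp only [mem_product] at hp'
      have := hcon a hp'.1 b hp'.2.1 c hp'.2.2
      simp only [mem_union, mem_filter, hp, true_and]
      tauto
    refine (card_le_card h1).trans ((card_union_le _ _).trans (add_le_add ((card_union_le _ _).trans
      (add_le_add ?_ ?_)) ?_))
    · have : #{p ∈ A ×ˢ B ×ˢ C | ¬ r p.1 p.2.1} ≤ R * #(A ×ˢ C) := by
        refine card_le_mul_card_image_of_maps_to (f := fun p => (p.1, p.2.2)) ?_ _ ?_
        · rintro ⟨a, b, c⟩ hp
          simp only [mem_filter, mem_product] at hp ⊢
          tauto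
        · rintro ⟨a, c⟩ hac
          refine le_trans (card_le_card_of_injOn (fun p => p.2.1) ?_ ?_) (hr a (mem_product.1 hac).1)
          · rintro ⟨a', b', c'⟩ hp
            simp only [mem_filter, mem_product, mem_coe, Prod.mk.injEq] at hp ⊢
            obtain ⟨⟨⟨h1, h2, h3⟩, h4⟩, rfl, rfl⟩ := hp
            exact ⟨h2, h4⟩
          · rintro ⟨a', b', c'⟩ hp ⟨a2, b2, c2⟩ hp2 hh
            simp only [mem_filter, mem_product, mem_coe, Prod.mk.injEq] at hp hp2 hh ⊢
            obtain ⟨-, rfl, rfl⟩ := hp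
            obtain ⟨-, rfl, rfl⟩ := hp2
            exact ⟨rfl, hh, rfl⟩
      rw [card_product] at this
      calc _ ≤ _ := this
        _ = _ := by ring
    · have : #{p ∈ A ×ˢ B ×ˢ C | ¬ s p.2.1 p.2.2} ≤ R * #(A ×ˢ B) := by
        refine card_le_mul_card_image_of_maps_to (f := fun p => (p.1, p.2.1)) ?_ _ ?_
        · rintro ⟨a, b, c⟩ hp
          simp only [mem_filter, mem_product] at hp ⊢
          tauto
        · rintro ⟨a, b⟩ hac
          refine le_trans (card_le_card_of_injOn (fun p => p.2.2) ?_ ?_) (hs b (mem_product.1 hac).2)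
          · rintro ⟨a', b', c'⟩ hp
            simp only [mem_filter, mem_product, mem_coe, Prod.mk.injEq] at hp ⊢
            obtain ⟨⟨⟨h1, h2, h3⟩, h4⟩, rfl, rfl⟩ := hp
            exact ⟨h3, h4⟩
          · rintro ⟨a', b', c'⟩ hp ⟨a2, b2, c2⟩ hp2 hh
            simp only [mem_filter, mem_product, mem_coe, Prod.mk.injEq] at hp hp2 hh ⊢
            obtain ⟨-, rfl, rfl⟩ := hp
            obtain ⟨-, rfl, rfl⟩ := hp2
            exact ⟨rfl, rfl, hh⟩
      rw [card_product] at this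
      calc _ ≤ _ := this
        _ = _ := by ring
    · have : #{p ∈ A ×ˢ B ×ˢ C | ¬ t p.2.2 p.1} ≤ R * #(B ×ˢ C) := by
        refine card_le_mul_card_image_of_maps_to (f := fun p => p.2) ?_ _ ?_
        · rintro ⟨a, b, c⟩ hp
          simp only [mem_filter, mem_product] at hp ⊢
          tauto
        · rintro ⟨b, c⟩ hac
          refine le_trans (card_le_card_of_injOn (fun p => p.1) ?_ ?_) (htt c (mem_product.1 hac).2)
          · rintro ⟨a', b', c'⟩ hp
            simp only [mem_filter, mem_product, mem_coe, Prod.mk.injEq] at hp ⊢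
            obtain ⟨⟨⟨h1, h2, h3⟩, h4⟩, rfl, rfl⟩ := hp
            exact ⟨h1, h4⟩
          · rintro ⟨a', b', c'⟩ hp ⟨a2, b2, c2⟩ hp2 hh
            simp only [mem_filter, mem_product, mem_coe, Prod.mk.injEq] at hp hp2 hh ⊢
            obtain ⟨-, rfl, rfl⟩ := hp
            obtain ⟨-, rfl, rfl⟩ := hp2
            exact ⟨hh, rfl, rfl⟩
      rw [card_product] at this
      calc _ ≤ _ := this
        _ = _ := by ring
  rw [card_product, card_product] at key
  have e1 : 3 * R * (#A * #C) < #B * (#A * #C) := Nat.mul_lt_mul_of_pos_right hB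
    (Nat.mul_pos (by omega) (by omega))
  have e2 : 3 * R * (#A * #B) < #C * (#A * #B) := Nat.mul_lt_mul_of_pos_right hC
    (Nat.mul_pos (by omega) (by omega))
  have e3 : 3 * R * (#B * #C) < #A * (#B * #C) := Nat.mul_lt_mul_of_pos_right hA
    (Nat.mul_pos (by omega) (by omega))
  nlinarith

lemma exists_small_linkPairs (ht : NoTriangle G) {U : Finset V} {c : ℕ} {x y z : V}
    (h : AlmostDom G U c x y z) :
    #(linkPairs G U c x) ≤ 20 * c * c ∨ #(linkPairs G U c y) ≤ 20 * c * c ∨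
      #(linkPairs G U c z) ≤ 20 * c * c := by
  by_contra! hcon
  obtain ⟨h1, h2, h3⟩ := hcon
  have a1 := card_linkPairs_le ht h
  have a2 := card_linkPairs_le ht h.swap12
  have a3 := card_linkPairs_le ht h.swap23.swap12
  have key := exists_cyclic_triple (crossPairs G U c x y z) (crossPairs G U c y x z)
    (crossPairs G U c z x y) (fun p q => G.Adj p.2 q.1) (fun q s => G.Adj q.1 s.2)
    (fun s p => G.Adj s.2 p.2) (2 * c * c) ?_ ?_ ?_ (by nlinarith) (by nlinarith) (by nlinarith)
  · obtain ⟨p, hp, q, hq, s, hs, e1, e2, e3⟩ := key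
    exact ht e1 e2 e3.symm
  · rintro ⟨y1, z1⟩ hp
    simp only [crossPairs, mem_filter, mem_linkPairs] at hp
    refine le_trans (card_le_card ?_) ((card_linkPairs_fst ht U
      {u ∈ U | ¬ G.Adj x u ∧ ¬ G.Adj y1 u ∧ ¬ G.Adj z1 u} c y).trans
        (Nat.mul_le_mul_left _ hp.1.2.2.2.2.2.2))
    rintro ⟨x2, z2⟩ hq
    simp only [crossPairs, mem_filter, mem_linkPairs] at hq ⊢
    obtain ⟨⟨hq1, hq2, hq3, hq4, hq5⟩, hq6⟩ := hq
    exact ⟨hq1, hq1.2.1, fun e => hq4 e.symm, fun e => ht e hq2 hp.2.1, hq6⟩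
  · rintro ⟨x2, z2⟩ hq
    simp only [crossPairs, mem_filter, mem_linkPairs] at hq
    refine le_trans (card_le_card ?_) ((card_linkPairs_snd ht U
      {u ∈ U | ¬ G.Adj y u ∧ ¬ G.Adj x2 u ∧ ¬ G.Adj z2 u} c z).trans
        (Nat.mul_le_mul_left _ hq.1.2.2.2.2.2.2))
    rintro ⟨x3, y3⟩ hs
    simp only [crossPairs, mem_filter, mem_linkPairs] at hs ⊢
    obtain ⟨⟨hs1, hs2, hs3, hs4, hs5⟩, hs6⟩ := hs
    exact ⟨hs1, hs1.2.2.1, fun e => hs5 e.symm, hs6, fun e => ht e hs3 hq.2.2.1⟩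
  · rintro ⟨x3, y3⟩ hs
    simp only [crossPairs, mem_filter, mem_linkPairs] at hs
    refine le_trans (card_le_card ?_) ((card_linkPairs_snd ht U
      {u ∈ U | ¬ G.Adj z u ∧ ¬ G.Adj x3 u ∧ ¬ G.Adj y3 u} c x).trans
        (Nat.mul_le_mul_left _ hs.1.2.2.2.2.2.2))
    rintro ⟨y1, z1⟩ hp
    simp only [crossPairs, mem_filter, mem_linkPairs] at hp ⊢
    obtain ⟨⟨hp1, hp2, hp3, hp4, hp5⟩, hp6⟩ := hp
    exact ⟨hp1, hp1.2.2.1, fun e => hp5 e.symm, fun e => ht e hp3 hs.2.1, hp6⟩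

/-- In a triangle-free graph, there are only linearly many almost dominating triples. -/
lemma card_almostDom_le (ht : NoTriangle G) (U : Finset V) (c : ℕ) :
    #{p ∈ U ×ˢ U ×ˢ U | AlmostDom G U c p.1 p.2.1 p.2.2} ≤ 60 * c * c * #U := by
  set S := {x ∈ U | #(linkPairs G U c x) ≤ 20 * c * c} with hS
  set Q := S.sigma (fun x => linkPairs G U c x) with hQ
  have hQc : #Q ≤ 20 * c * c * #U := by
    rw [hQ, card_sigma]
    calc ∑ x ∈ S, #(linkPairs G U c x) ≤ ∑ x ∈ S, 20 * c * c :=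
          sum_le_sum fun x hx => (mem_filter.1 hx).2
      _ = #S * (20 * c * c) := by rw [sum_const, smul_eq_mul]
      _ ≤ #U * (20 * c * c) := Nat.mul_le_mul_right _ (card_filter_le _ _)
      _ = _ := by ring
  have hsub : {p ∈ U ×ˢ U ×ˢ U | AlmostDom G U c p.1 p.2.1 p.2.2} ⊆
      Q.image (fun q => (q.1, q.2.1, q.2.2)) ∪ Q.image (fun q => (q.2.1, q.1, q.2.2)) ∪
      Q.image (fun q => (q.2.1, q.2.2, q.1)) := by
    rintro ⟨x, y, z⟩ hp
    simp only [mem_filter] at hp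
    have h := hp.2
    simp only [mem_union, mem_image]
    have h2 := h.swap12
    have h3 := h.swap23.swap12
    rcases exists_small_linkPairs ht h with h' | h' | h'
    · exact Or.inl (Or.inl ⟨⟨x, y, z⟩, by
        simp [hQ, hS, mem_linkPairs, h, h', h.1], rfl⟩)
    · exact Or.inl (Or.inr ⟨⟨y, x, z⟩, by
        simp [hQ, hS, mem_linkPairs, h2, h', h.2.1], rfl⟩)
    · exact Or.inr ⟨⟨z, x, y⟩, by
        simp [hQ, hS, mem_linkPairs, h3, h', h.2.2.1], rfl⟩
  have h1 := card_le_card hsub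
  have h2 := h1.trans (card_union_le _ _)
  have h3 := card_union_le (Q.image (fun q => (q.1, q.2.1, q.2.2)))
    (Q.image (fun q => (q.2.1, q.1, q.2.2)))
  have h4 := card_image_le (s := Q) (f := fun q => (q.1, q.2.1, q.2.2))
  have h5 := card_image_le (s := Q) (f := fun q => (q.2.1, q.1, q.2.2))
  have h6 := card_image_le (s := Q) (f := fun q => (q.2.1, q.2.2, q.1))
  nlinarith

/-- `x, y, z` are distinct pairwise non-adjacent vertices dominating `U`, each having at least
three private neighbours in `U`. -/
structure ExactTriple (G : SimpleGraph V) (U : Finset V) (x y z : V) : Prop where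
  mem₁ : x ∈ U
  mem₂ : y ∈ U
  mem₃ : z ∈ U
  ne₁₂ : x ≠ y
  ne₁₃ : x ≠ z
  ne₂₃ : y ≠ z
  nadj₁₂ : ¬ G.Adj x y
  nadj₁₃ : ¬ G.Adj x z
  nadj₂₃ : ¬ G.Adj y z
  dom : ∀ u ∈ U, u ≠ x → u ≠ y → u ≠ z → ¬ G.Adj x u → ¬ G.Adj y u → G.Adj z u
  priv₁ : ∀ p q, ∃ u ∈ U, u ≠ p ∧ u ≠ q ∧ G.Adj x u ∧ ¬ G.Adj y u ∧ ¬ G.Adj z u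
  priv₂ : ∀ p q, ∃ u ∈ U, u ≠ p ∧ u ≠ q ∧ G.Adj y u ∧ ¬ G.Adj x u ∧ ¬ G.Adj z u
  priv₃ : ∀ p q, ∃ u ∈ U, u ≠ p ∧ u ≠ q ∧ G.Adj z u ∧ ¬ G.Adj x u ∧ ¬ G.Adj y u

namespace ExactTriple

variable {U : Finset V} {x y z : V}

lemma swap₁₂ (h : ExactTriple G U x y z) : ExactTriple G U y x z where
  mem₁ := h.mem₂
  mem₂ := h.mem₁
  mem₃ := h.mem₃
  ne₁₂ := h.ne₁₂.symm
  ne₁₃ := h.ne₂₃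
  ne₂₃ := h.ne₁₃
  nadj₁₂ e := h.nadj₁₂ e.symm
  nadj₁₃ := h.nadj₂₃
  nadj₂₃ := h.nadj₁₃
  dom u hu a b c d e := h.dom u hu b a c e d
  priv₁ := h.priv₂
  priv₂ := h.priv₁
  priv₃ p q := by
    obtain ⟨u, a, b, c, d, e, f⟩ := h.priv₃ p q
    exact ⟨u, a, b, c, d, f, e⟩

lemma swap₂₃ (h : ExactTriple G U x y z) : ExactTriple G U x z y where
  mem₁ := h.mem₁
  mem₂ := h.mem₃
  mem₃ := h.mem₂
  ne₁₂ := h.ne₁₃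
  ne₁₃ := h.ne₁₂
  ne₂₃ := h.ne₂₃.symm
  nadj₁₂ := h.nadj₁₃
  nadj₁₃ := h.nadj₁₂
  nadj₂₃ e := h.nadj₂₃ e.symm
  dom u hu a b c d e := by
    by_contra hh
    exact e (h.dom u hu a c b d hh)
  priv₁ p q := by
    obtain ⟨u, a, b, c, d, e, f⟩ := h.priv₁ p q
    exact ⟨u, a, b, c, d, f, e⟩
  priv₂ := h.priv₃
  priv₃ := h.priv₂

lemma rot (h : ExactTriple G U x y z) : ExactTriple G U y z x := h.swap₁₂.swap₂₃

lemma unique_third (ht : NoTriangle G) {z' : V} (h : ExactTriple G U x y z)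
    (h' : ExactTriple G U x y z') : z = z' := by
  by_contra hne
  have h1 : G.Adj z z' := h.dom z' h'.mem₃ h'.ne₁₃.symm h'.ne₂₃.symm (Ne.symm hne)
    h'.nadj₁₃ h'.nadj₂₃
  obtain ⟨p, hp, hpz', -, h2, h3, h4⟩ := h.priv₃ z' z'
  have h5 : G.Adj z' p := h'.dom p hp (fun e => h.nadj₁₃ (e ▸ h2.symm))
    (fun e => h.nadj₂₃ (e ▸ h2.symm)) hpz' h3 h4
  exact ht h1 h5 h2

lemma nadj_of_adj_of_adj (ht : NoTriangle G) {a b c d : V} (h : ExactTriple G U x a b)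
    (h' : ExactTriple G U x c d) (had : a ≠ d) (hbd : b ≠ d)
    (h1 : G.Adj c a) (h2 : G.Adj c b) : False := by
  have key : ∀ a b : V, ExactTriple G U x a b → G.Adj c a → ¬ G.Adj d a := by
    intro a b h h1 h2
    obtain ⟨p, hp, hpc, hpd, e1, e2, e3⟩ := h.priv₂ c d
    exact ht h2 e1 (h'.dom p hp (fun e => h.nadj₁₂ (e ▸ e1.symm)) hpc hpd e2
      (fun e => ht h1 e1 e))
  have hd : G.Adj b d := h.dom d h'.mem₃ h'.ne₁₃.symm had.symm hbd.symm h'.nadj₁₃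
    (fun e => key a b h h1 e.symm)
  exact key b a h.swap₂₃ h2 hd.symm

/-- Two exact triples sharing just one vertex are joined crosswise. -/
lemma cross (ht : NoTriangle G) {a b c d : V} (h : ExactTriple G U x a b)
    (h' : ExactTriple G U x c d) (hac : a ≠ c) (had : a ≠ d) (hbd : b ≠ d) (hbc : b ≠ c) :
    (G.Adj a c ∧ G.Adj b d ∧ ¬ G.Adj a d ∧ ¬ G.Adj b c) ∨
      (G.Adj a d ∧ G.Adj b c ∧ ¬ G.Adj a c ∧ ¬ G.Adj b d) := by
  have e1 : G.Adj a c → ¬ G.Adj b c := fun h1 h2 =>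
    nadj_of_adj_of_adj ht h h' had hbd h1.symm h2.symm
  have e2 : G.Adj a d → ¬ G.Adj b d := fun h1 h2 =>
    nadj_of_adj_of_adj ht h h'.swap₂₃ hac hbc h1.symm h2.symm
  have e3 : G.Adj a c → ¬ G.Adj a d := fun h1 h2 =>
    nadj_of_adj_of_adj ht h' h hbc.symm hbd.symm h1 h2
  have f1 : ¬ G.Adj a c → G.Adj b c :=
    h.dom c h'.mem₂ h'.ne₁₂.symm hac.symm hbc.symm h'.nadj₁₂
  have f2 : ¬ G.Adj a d → G.Adj b d :=
    h.dom d h'.mem₃ h'.ne₁₃.symm had.symm hbd.symm h'.nadj₁₃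
  have e4 : G.Adj b c → ¬ G.Adj b d := fun h1 h2 =>
    nadj_of_adj_of_adj ht h' h.swap₂₃ hac.symm had.symm h1 h2
  tauto

end ExactTriple

/-- An exact triple `x, y, z` with three further exact triples, one through each of its vertices,
labelled according to the crosswise adjacencies. -/
structure Petals (G : SimpleGraph V) (U : Finset V) (x y z y₁ z₁ z₂ x₂ x₃ y₃ : V) : Prop where
  core : ExactTriple G U x y z
  petal₁ : ExactTriple G U x y₁ z₁
  petal₂ : ExactTriple G U y z₂ x₂
  petal₃ : ExactTriple G U z x₃ y₃
  adj₁ : G.Adj y z₁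
  adj₁' : G.Adj z y₁
  nadj₁ : ¬ G.Adj y y₁
  nadj₁' : ¬ G.Adj z z₁
  adj₂ : G.Adj z x₂
  adj₂' : G.Adj x z₂
  nadj₂ : ¬ G.Adj z z₂
  nadj₂' : ¬ G.Adj x x₂
  adj₃ : G.Adj x y₃
  adj₃' : G.Adj y x₃
  nadj₃ : ¬ G.Adj x x₃
  nadj₃' : ¬ G.Adj y y₃

namespace Petals

variable {U : Finset V} {x y z y₁ z₁ z₂ x₂ x₃ y₃ : V}

lemma rot (h : Petals G U x y z y₁ z₁ z₂ x₂ x₃ y₃) : Petals G U y z x z₂ x₂ x₃ y₃ y₁ z₁ where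
  core := h.core.rot
  petal₁ := h.petal₂
  petal₂ := h.petal₃
  petal₃ := h.petal₁
  adj₁ := h.adj₂
  adj₁' := h.adj₂'
  nadj₁ := h.nadj₂
  nadj₁' := h.nadj₂'
  adj₂ := h.adj₃
  adj₂' := h.adj₃'
  nadj₂ := h.nadj₃
  nadj₂' := h.nadj₃'
  adj₃ := h.adj₁
  adj₃' := h.adj₁'
  nadj₃ := h.nadj₁
  nadj₃' := h.nadj₁'

lemma adj_of_ne (ht : NoTriangle G) (h : Petals G U x y z y₁ z₁ z₂ x₂ x₃ y₃) (hne : x₂ ≠ y₁) :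
    G.Adj z₁ x₂ ∧ G.Adj y₁ z₂ := by
  constructor
  · refine h.petal₁.dom x₂ h.petal₂.mem₃ ?_ hne ?_ h.nadj₂' (fun e => ht h.adj₁' e h.adj₂)
    · rintro rfl
      exact h.core.nadj₁₃ h.adj₂.symm
    · rintro rfl
      exact h.nadj₁' h.adj₂
  · refine (h.petal₂.swap₂₃.dom y₁ h.petal₁.mem₂ ?_ hne.symm ?_ h.nadj₁
      (fun e => ht h.adj₂ e h.adj₁')).symm
    · rintro rfl
      exact h.core.nadj₂₃ h.adj₁'.symm
    · rintro rfl
      exact h.nadj₂ h.adj₁'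

lemma some_eq (ht : NoTriangle G) (h : Petals G U x y z y₁ z₁ z₂ x₂ x₃ y₃) :
    x₂ = y₁ ∨ z₁ = x₃ ∨ y₃ = z₂ := by
  by_contra! hcon
  obtain ⟨h1, h2, h3⟩ := hcon
  have e1 := (h.adj_of_ne ht h1).1
  have e2 := (h.rot.adj_of_ne ht h3).1
  have e3 := (h.rot.rot.adj_of_ne ht h2).1
  exact ht e2 e3 e1.symm

lemma two_eq (ht : NoTriangle G) (h : Petals G U x y z y₁ z₁ z₂ x₂ x₃ y₃) (hp : x₂ = y₁) :
    z₁ = x₃ ∨ y₃ = z₂ := by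
  by_contra! hcon
  obtain ⟨h2, h3⟩ := hcon
  have e1 := (h.rot.adj_of_ne ht h3).1
  have e2 := (h.rot.rot.adj_of_ne ht h2).2
  rw [← hp] at e2
  obtain ⟨n, hn, hny, hnz, a1, a2, a3⟩ := h.petal₂.priv₃ y₃ z
  have := h.petal₃.dom n hn hnz (fun e => a2 (e ▸ h.adj₃')) hny (fun e => ht h.adj₂ a1 e)
    (fun e => ht e2 a1 e)
  exact ht e1 this a1

lemma three_eq (ht : NoTriangle G) (h : Petals G U x y z y₁ z₁ z₂ x₂ x₃ y₃) (hp : x₂ = y₁)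
    (hq : z₁ = x₃) : y₃ = z₂ := by
  by_contra hr
  have e2 := (h.rot.adj_of_ne ht hr).2
  subst hp hq
  rcases h.petal₁.rot.swap₂₃.cross ht h.petal₂.rot.rot h.core.ne₁₂ h.adj₂'.ne e2.ne.symm h.adj₁.ne.symm
    with h1 | h1
  · exact h.core.nadj₁₂ h1.1
  · exact h1.2.2.2 e2.symm

lemma all_eq (ht : NoTriangle G) (h : Petals G U x y z y₁ z₁ z₂ x₂ x₃ y₃) :
    y₁ = x₂ ∧ z₁ = x₃ := by
  have a := h.some_eq ht
  have b1 := h.two_eq ht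
  have b2 := h.rot.two_eq ht
  have b3 := h.rot.rot.two_eq ht
  have c1 := h.three_eq ht
  have c2 := h.rot.three_eq ht
  have c3 := h.rot.rot.three_eq ht
  rw [eq_comm (a := y₁)]
  tauto

end Petals

/-- A set whose elements, listed in some order, form an exact triple. -/
def IsExactTriple (G : SimpleGraph V) (U T : Finset V) : Prop :=
  ∃ x y z, T = {x, y, z} ∧ ExactTriple G U x y z

namespace IsExactTriple

variable {U T : Finset V}

lemma exists_of_mem (h : IsExactTriple G U T) {x : V} (hx : x ∈ T) :
    ∃ y z, T = {x, y, z} ∧ ExactTriple G U x y z := by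
  obtain ⟨a, b, c, rfl, h⟩ := h
  simp only [mem_insert, mem_singleton] at hx
  rcases hx with rfl | rfl | rfl
  · exact ⟨b, c, rfl, h⟩
  · exact ⟨a, c, by ext; simp; tauto, h.swap₁₂⟩
  · exact ⟨a, b, by ext; simp; tauto, h.rot.rot⟩

lemma exists_cross (ht : NoTriangle G) {x y z : V} (h : ExactTriple G U x y z)
    (h' : IsExactTriple G U T) (hx : x ∈ T) (hT : T ≠ {x, y, z}) :
    ∃ y₁ z₁, T = {x, y₁, z₁} ∧ ExactTriple G U x y₁ z₁ ∧ G.Adj y z₁ ∧ G.Adj z y₁ ∧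
      ¬ G.Adj y y₁ ∧ ¬ G.Adj z z₁ := by
  obtain ⟨a, b, hab, h'⟩ := h'.exists_of_mem hx
  have n1 : y ≠ a := by
    rintro rfl
    exact hT (hab.trans (by rw [h.unique_third ht h']))
  have n2 : y ≠ b := by
    rintro rfl
    refine hT (hab.trans ?_)
    rw [h.unique_third ht h'.swap₂₃]; ext; simp; tauto
  have n3 : z ≠ a := by
    rintro rfl
    refine hT (hab.trans ?_)
    rw [h.swap₂₃.unique_third ht h']; ext; simp; tauto
  have n4 : z ≠ b := by
    rintro rfl
    refine hT (hab.trans ?_)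
    rw [h.swap₂₃.unique_third ht h'.swap₂₃]
  rcases h.cross ht h' n1 n2 n4 n3 with ⟨h1, h2, h3, h4⟩ | ⟨h1, h2, h3, h4⟩
  · exact ⟨b, a, by rw [hab]; ext; simp; tauto, h'.swap₂₃, h1, h2, h3, h4⟩
  · exact ⟨a, b, hab, h', h1, h2, h3, h4⟩

end IsExactTriple

lemma card_filter_mem_eq_two (ht : NoTriangle G) {U : Finset V} {𝓣 : Finset (Finset V)}
    (h𝓣 : ∀ T ∈ 𝓣, IsExactTriple G U T) {x y z : V} (h : ExactTriple G U x y z)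
    (hy : 2 ≤ #{T ∈ 𝓣 | y ∈ T}) (hz : 2 ≤ #{T ∈ 𝓣 | z ∈ T}) :
    #{T ∈ 𝓣 | x ∈ T} ≤ 2 := by
  have ex : ∀ w, 2 ≤ #{T ∈ 𝓣 | w ∈ T} → ∃ T ∈ 𝓣, w ∈ T ∧ T ≠ {x, y, z} := by
    intro w hw
    obtain ⟨T, hT, hne⟩ := exists_mem_ne hw {x, y, z}
    rw [mem_filter] at hT
    exact ⟨T, hT.1, hT.2, hne⟩
  obtain ⟨Q2, hQ2, hy2, hne2⟩ := ex y hy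
  obtain ⟨Q3, hQ3, hz3, hne3⟩ := ex z hz
  obtain ⟨z2, x2, -, h2, a2, b2, c2, d2⟩ := IsExactTriple.exists_cross ht h.rot (h𝓣 Q2 hQ2) hy2
    (fun e => hne2 (e.trans (by ext; simp; tauto)))
  obtain ⟨x3, y3, -, h3, a3, b3, c3, d3⟩ := IsExactTriple.exists_cross ht h.rot.rot (h𝓣 Q3 hQ3) hz3
    (fun e => hne3 (e.trans (by ext; simp; tauto)))
  have : {T ∈ 𝓣 | x ∈ T} ⊆ {{x, y, z}, {x, x2, x3}} := by
    intro T hT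
    rw [mem_filter] at hT
    rw [mem_insert, mem_singleton, or_iff_not_imp_left]
    intro hne
    obtain ⟨y1, z1, hT', h1, a1, b1, c1, d1⟩ :=
      IsExactTriple.exists_cross ht h (h𝓣 T hT.1) hT.2 hne
    obtain ⟨e1, e2⟩ := Petals.all_eq ht
      ⟨h, h1, h2, h3, a1, b1, c1, d1, a2, b2, c2, d2, a3, b3, c3, d3⟩
    rw [hT', e1, e2]
  exact (card_le_card this).trans card_le_two

/-- There are at most as many exact triples as vertices. -/
lemma card_exactTriples_le (ht : NoTriangle G) {U : Finset V} {𝓣 : Finset (Finset V)}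
    (h𝓣 : ∀ T ∈ 𝓣, IsExactTriple G U T) : #𝓣 ≤ #U := by
  set d : V → ℕ := fun w => #{T ∈ 𝓣 | w ∈ T} with hd
  have hw : ∀ T ∈ 𝓣, (1 : ℚ) ≤ ∑ w ∈ T, 1 / (d w : ℚ) := by
    intro T hT
    obtain ⟨x, y, z, rfl, h⟩ := h𝓣 T hT
    have hpos : ∀ w ∈ ({x, y, z} : Finset V), 1 ≤ d w := fun w hw =>
      card_pos.2 ⟨_, mem_filter.2 ⟨hT, hw⟩⟩
    rw [sum_insert (by simp [h.ne₁₂, h.ne₁₃]), sum_insert (by simp [h.ne₂₃]), sum_singleton]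
    have px := hpos x (by simp)
    have py := hpos y (by simp)
    have pz := hpos z (by simp)
    have qx : 0 ≤ 1 / (d x : ℚ) := by positivity
    have qy : 0 ≤ 1 / (d y : ℚ) := by positivity
    have qz : 0 ≤ 1 / (d z : ℚ) := by positivity
    rcases px.eq_or_lt with hx | hx
    · rw [← hx, Nat.cast_one, div_one]; linarith
    rcases py.eq_or_lt with hy | hy
    · rw [← hy, Nat.cast_one, div_one]; linarith
    rcases pz.eq_or_lt with hz | hz
    · rw [← hz, Nat.cast_one, div_one]; linarith
    have ex : d x = 2 := le_antisymm (card_filter_mem_eq_two ht h𝓣 h hy hz) hx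
    have ey : d y = 2 := le_antisymm (card_filter_mem_eq_two ht h𝓣 h.rot hz hx) hy
    rw [ex, ey, Nat.cast_ofNat]
    linarith
  have hsub : ∀ T ∈ 𝓣, T ⊆ U := by
    intro T hT
    obtain ⟨x, y, z, rfl, h⟩ := h𝓣 T hT
    intro u hu
    simp only [mem_insert, mem_singleton] at hu
    rcases hu with rfl | rfl | rfl
    exacts [h.mem₁, h.mem₂, h.mem₃]
  have : (#𝓣 : ℚ) ≤ #U := by
    calc (#𝓣 : ℚ) = ∑ T ∈ 𝓣, (1 : ℚ) := by simp
      _ ≤ ∑ T ∈ 𝓣, ∑ w ∈ T, 1 / (d w : ℚ) := sum_le_sum hw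
      _ = ∑ T ∈ 𝓣, ∑ w ∈ U, if w ∈ T then 1 / (d w : ℚ) else 0 := by
          refine sum_congr rfl fun T hT => ?_
          rw [← sum_filter, filter_mem_eq_inter, inter_eq_right.2 (hsub T hT)]
      _ = ∑ w ∈ U, ∑ T ∈ 𝓣, if w ∈ T then 1 / (d w : ℚ) else 0 := sum_comm
      _ = ∑ w ∈ U, (d w : ℚ) * (1 / (d w : ℚ)) := by
          refine sum_congr rfl fun w _ => ?_
          rw [← sum_filter, sum_const, nsmul_eq_mul]
      _ ≤ ∑ w ∈ U, (1 : ℚ) := by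
          refine sum_le_sum fun w _ => ?_
          rw [mul_one_div]
          exact div_self_le_one _
      _ = #U := by simp
  exact_mod_cast this

/-- `Q` is an independent set of four vertices of `U` dominating `U`. -/
structure DomQuad (G : SimpleGraph V) (U Q : Finset V) : Prop where
  sub : Q ⊆ U
  card : #Q = 4
  nadj : ∀ x ∈ Q, ∀ y ∈ Q, ¬ G.Adj x y
  dom : ∀ u ∈ U, u ∉ Q → ∃ x ∈ Q, G.Adj x u

/-- The vertices of `U` that no element of `Q` other than `w` dominates. -/
noncomputable def soleSet (G : SimpleGraph V) (U Q : Finset V) (w : V) : Finset V :=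
  {u ∈ U | ∀ x ∈ Q, x ≠ w → ¬ G.Adj x u}

lemma card_badQuads_le (ht : NoTriangle G) {U : Finset V} {𝒬 : Finset (Finset V)}
    (h𝒬 : ∀ Q ∈ 𝒬, DomQuad G U Q ∧ ∃ w ∈ Q, #(soleSet G U Q w) ≤ 6) :
    #𝒬 ≤ 12960 * #U := by
  set 𝒯 := {p ∈ U ×ˢ U ×ˢ U | AlmostDom G U 6 p.1 p.2.1 p.2.2} with h𝒯
  set 𝒮 := 𝒯.sigma (fun p => {u ∈ U | ¬ G.Adj p.1 u ∧ ¬ G.Adj p.2.1 u ∧ ¬ G.Adj p.2.2 u}) with h𝒮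
  have hsub : 𝒬 ⊆ 𝒮.image (fun s => {s.2, s.1.1, s.1.2.1, s.1.2.2}) := by
    intro Q hQ
    obtain ⟨hd, w, hw, hc⟩ := h𝒬 Q hQ
    have h3 : #(Q.erase w) = 3 := by rw [card_erase_of_mem hw, hd.card]
    obtain ⟨x, y, z, hxy, hxz, hyz, he⟩ := card_eq_three.1 h3
    have hQe : Q = {w, x, y, z} := by rw [← he, insert_erase hw]
    have hx : x ∈ Q.erase w := by rw [he]; simp
    have hy : y ∈ Q.erase w := by rw [he]; simp
    have hz : z ∈ Q.erase w := by rw [he]; simp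
    rw [mem_erase] at hx hy hz
    have hs : soleSet G U Q w = {u ∈ U | ¬ G.Adj x u ∧ ¬ G.Adj y u ∧ ¬ G.Adj z u} := by
      ext u
      simp only [soleSet, mem_filter, and_congr_right_iff]
      intro _
      rw [hQe]
      simp only [mem_insert, mem_singleton]
      constructor
      · intro h
        exact ⟨h x (by simp) hx.1, h y (by simp) hy.1, h z (by simp) hz.1⟩
      · rintro ⟨h1, h2, h3⟩ v (rfl | rfl | rfl | rfl) hne
        exacts [absurd rfl hne, h1, h2, h3]
    rw [mem_image]
    refine ⟨⟨(x, y, z), w⟩, ?_, hQe.symm⟩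
    simp only [h𝒮, h𝒯, mem_sigma, mem_filter, mem_product]
    refine ⟨⟨⟨hd.sub hx.2, hd.sub hy.2, hd.sub hz.2⟩, hd.sub hx.2, hd.sub hy.2, hd.sub hz.2,
      hd.nadj _ hx.2 _ hy.2, hd.nadj _ hx.2 _ hz.2, hd.nadj _ hy.2 _ hz.2, hs ▸ hc⟩, hd.sub hw,
      hd.nadj _ hx.2 _ hw, hd.nadj _ hy.2 _ hw, hd.nadj _ hz.2 _ hw⟩
  have h1 : #𝒮 ≤ #𝒯 * 6 := by
    rw [h𝒮, card_sigma]
    refine sum_le_card_nsmul _ _ _ fun p hp => ?_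
    exact (mem_filter.1 hp).2.2.2.2.2.2.2
  have h2 : #𝒯 ≤ 60 * 6 * 6 * #U := card_almostDom_le ht U 6
  have h3 := (card_le_card hsub).trans card_image_le
  omega

lemma isExactTriple_erase {U Q : Finset V} (hd : DomQuad G U Q)
    (hg : ∀ w ∈ Q, 6 < #(soleSet G U Q w)) {o : V} (ho : o ∈ Q) :
    IsExactTriple G {u ∈ U | u ≠ o ∧ ¬ G.Adj o u} (Q.erase o) := by
  have h3 : #(Q.erase o) = 3 := by rw [card_erase_of_mem ho, hd.card]
  obtain ⟨x, y, z, hxy, hxz, hyz, he⟩ := card_eq_three.1 h3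
  have hQe : Q = {o, x, y, z} := by rw [← he, insert_erase ho]
  have hx : x ∈ Q.erase o := by rw [he]; simp
  have hy : y ∈ Q.erase o := by rw [he]; simp
  have hz : z ∈ Q.erase o := by rw [he]; simp
  rw [mem_erase] at hx hy hz
  have hpriv : ∀ w ∈ Q, ∀ p q, ∃ u ∈ U, u ∉ Q ∧ u ≠ p ∧ u ≠ q ∧ G.Adj w u ∧
      ∀ x ∈ Q, x ≠ w → ¬ G.Adj x u := by
    intro w hw p q
    have hc : #(Q ∪ {p, q}) < #(soleSet G U Q w) := by
      have h1 := card_union_le Q {p, q}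
      have h2 : #({p, q} : Finset V) ≤ 2 := card_le_two
      have h3 := hg w hw
      rw [hd.card] at h1
      omega
    obtain ⟨u, hu, hu'⟩ := exists_mem_notMem_of_card_lt_card hc
    simp only [mem_union, mem_insert, mem_singleton, not_or] at hu'
    simp only [soleSet, mem_filter] at hu
    refine ⟨u, hu.1, hu'.1, hu'.2.1, hu'.2.2, ?_, hu.2⟩
    obtain ⟨v, hv, hadj⟩ := hd.dom u hu.1 hu'.1
    by_cases h : v = w
    · exact h ▸ hadj
    · exact absurd hadj (hu.2 v hv h)
  have hpriv' : ∀ w ∈ Q, w ≠ o → ∀ p q, ∃ u ∈ {u ∈ U | u ≠ o ∧ ¬ G.Adj o u},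
      u ≠ p ∧ u ≠ q ∧ G.Adj w u ∧ ∀ x ∈ Q, x ≠ w → ¬ G.Adj x u := by
    intro w hw hwo p q
    obtain ⟨u, h1, h2, h3, h4, h5, h6⟩ := hpriv w hw p q
    exact ⟨u, mem_filter.2 ⟨h1, fun e => h2 (e ▸ ho), h6 o ho hwo.symm⟩, h3, h4, h5, h6⟩
  refine ⟨x, y, z, he, ?_⟩
  constructor
  · exact mem_filter.2 ⟨hd.sub hx.2, hx.1, hd.nadj _ ho _ hx.2⟩
  · exact mem_filter.2 ⟨hd.sub hy.2, hy.1, hd.nadj _ ho _ hy.2⟩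
  · exact mem_filter.2 ⟨hd.sub hz.2, hz.1, hd.nadj _ ho _ hz.2⟩
  · exact hxy
  · exact hxz
  · exact hyz
  · exact hd.nadj _ hx.2 _ hy.2
  · exact hd.nadj _ hx.2 _ hz.2
  · exact hd.nadj _ hy.2 _ hz.2
  · intro u hu h1 h2 h3 h4 h5
    rw [mem_filter] at hu
    obtain ⟨v, hv, hadj⟩ := hd.dom u hu.1 (by
      rw [hQe]; simp only [mem_insert, mem_singleton, not_or]; exact ⟨hu.2.1, h1, h2, h3⟩)
    rw [hQe] at hv
    simp only [mem_insert, mem_singleton] at hv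
    rcases hv with rfl | rfl | rfl | rfl
    exacts [absurd hadj hu.2.2, absurd hadj h4, absurd hadj h5, hadj]
  · intro p q
    obtain ⟨u, h1, h2, h3, h4, h5⟩ := hpriv' x hx.2 hx.1 p q
    exact ⟨u, h1, h2, h3, h4, h5 y hy.2 hxy.symm, h5 z hz.2 hxz.symm⟩
  · intro p q
    obtain ⟨u, h1, h2, h3, h4, h5⟩ := hpriv' y hy.2 hy.1 p q
    exact ⟨u, h1, h2, h3, h4, h5 x hx.2 hxy, h5 z hz.2 hyz.symm⟩
  · intro p q
    obtain ⟨u, h1, h2, h3, h4, h5⟩ := hpriv' z hz.2 hz.1 p q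
    exact ⟨u, h1, h2, h3, h4, h5 x hx.2 hxz, h5 y hy.2 hyz⟩

lemma card_goodQuads_le (ht : NoTriangle G) {U : Finset V} {𝒬 : Finset (Finset V)}
    (h𝒬 : ∀ Q ∈ 𝒬, DomQuad G U Q ∧ ∀ w ∈ Q, 6 < #(soleSet G U Q w)) :
    4 * #𝒬 ≤ 3 * ∑ x ∈ U, #{u ∈ U | G.Adj x u} + 6 * #U := by
  set d : V → ℕ := fun x => #{u ∈ U | G.Adj x u} with hd
  set w : V → ℕ := fun o => #{Q ∈ 𝒬 | o ∈ Q} with hw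
  have hwd : ∀ o ∈ U, w o + d o ≤ #U := by
    intro o ho
    have h1 : w o ≤ #{u ∈ U | u ≠ o ∧ ¬ G.Adj o u} := by
      have hinj : Set.InjOn (fun Q : Finset V => Q.erase o) ({Q ∈ 𝒬 | o ∈ Q} : Finset _) := by
        intro Q hQ Q' hQ' h
        rw [mem_coe, mem_filter] at hQ hQ'
        rw [← insert_erase hQ.2, ← insert_erase hQ'.2]
        exact congrArg _ h
      refine (card_image_of_injOn hinj).symm.trans_le ?_
      refine card_exactTriples_le ht ?_
      intro T hT
      obtain ⟨Q, hQ, rfl⟩ := mem_image.1 hT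
      rw [mem_filter] at hQ
      exact isExactTriple_erase (h𝒬 Q hQ.1).1 (h𝒬 Q hQ.1).2 hQ.2
    have h2 : #{u ∈ U | u ≠ o ∧ ¬ G.Adj o u} ≤ #{u ∈ U | ¬ G.Adj o u} :=
      card_le_card fun u => by simp only [mem_filter]; tauto
    have h3 := card_filter_add_card_filter_not (s := U) (fun u => G.Adj o u)
    simp only [hd]
    omega
  have hdom : ∀ Q ∈ 𝒬, #U ≤ 4 + ∑ o ∈ Q, d o := by
    intro Q hQ
    have hq := (h𝒬 Q hQ).1
    have : U ⊆ Q ∪ Q.biUnion fun o => {u ∈ U | G.Adj o u} := by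
      intro u hu
      by_cases h : u ∈ Q
      · exact mem_union_left _ h
      · obtain ⟨x, hx, hxu⟩ := hq.dom u hu h
        exact mem_union_right _ (mem_biUnion.2 ⟨x, hx, mem_filter.2 ⟨hu, hxu⟩⟩)
    refine (card_le_card this).trans ((card_union_le _ _).trans ?_)
    rw [hq.card]
    exact Nat.add_le_add_left card_biUnion_le _
  have hswap : ∀ f : V → ℕ, ∑ Q ∈ 𝒬, ∑ o ∈ Q, f o = ∑ o ∈ U, w o * f o := by
    intro f
    calc ∑ Q ∈ 𝒬, ∑ o ∈ Q, f o = ∑ Q ∈ 𝒬, ∑ o ∈ U, if o ∈ Q then f o else 0 := by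
          refine sum_congr rfl fun Q hQ => ?_
          rw [← sum_filter, filter_mem_eq_inter, inter_eq_right.2 (h𝒬 Q hQ).1.sub]
      _ = ∑ o ∈ U, ∑ Q ∈ 𝒬, if o ∈ Q then f o else 0 := sum_comm
      _ = ∑ o ∈ U, w o * f o := by
          refine sum_congr rfl fun o _ => ?_
          rw [← sum_filter, sum_const, smul_eq_mul]
  have hsum : 4 * #𝒬 = ∑ o ∈ U, w o := by
    have := hswap fun _ => 1
    simp only [mul_one, sum_const, smul_eq_mul] at this
    rw [← this, sum_congr rfl fun Q hQ => (h𝒬 Q hQ).1.card]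
    simp [mul_comm]
  have hsumd : #𝒬 * #U ≤ 4 * #𝒬 + ∑ o ∈ U, w o * d o := by
    rw [← hswap]
    calc #𝒬 * #U = ∑ Q ∈ 𝒬, #U := by simp
      _ ≤ ∑ Q ∈ 𝒬, (4 + ∑ o ∈ Q, d o) := sum_le_sum hdom
      _ = _ := by rw [sum_add_distrib]; simp [mul_comm]
  have hpt : ∀ o ∈ U, 16 * (w o * d o) ≤ 9 * #U * d o + #U * w o := by
    intro o ho
    have h := hwd o ho
    generalize w o = a at *
    generalize d o = b at *
    generalize #U = m at *
    rcases le_total (16 * b) m with h1 | h1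
    · nlinarith [Nat.mul_le_mul_left a h1]
    · zify at *
      nlinarith [sq_nonneg (4 * (b : ℤ) - m), mul_le_mul_of_nonneg_right
        (show (a : ℤ) ≤ m - b by linarith) (show (0 : ℤ) ≤ 16 * b - m by linarith)]
  have htot : 16 * ∑ o ∈ U, w o * d o ≤ 9 * #U * ∑ o ∈ U, d o + #U * ∑ o ∈ U, w o := by
    rw [mul_sum, mul_sum, mul_sum, ← sum_add_distrib]
    exact sum_le_sum hpt
  have hw2 : ∑ o ∈ U, w o ≤ #U * #U := by
    rw [← smul_eq_mul]
    exact sum_le_card_nsmul _ _ _ fun o ho => (Nat.le_add_right _ _).trans (hwd o ho)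
  rw [← hsum] at htot hw2
  rcases Nat.eq_zero_or_pos (#U) with h0 | h0
  · rw [h0] at hw2
    omega
  · refine Nat.le_of_mul_le_mul_left (c := #U) ?_ h0
    nlinarith

/-- The number of dominating independent quadruples, in terms of the edges they span. -/
lemma card_domQuads_le (ht : NoTriangle G) {U : Finset V} {𝒬 : Finset (Finset V)}
    (h𝒬 : ∀ Q ∈ 𝒬, DomQuad G U Q) :
    4 * #𝒬 ≤ 3 * ∑ x ∈ U, #{u ∈ U | G.Adj x u} + 51846 * #U := by
  have h1 := card_badQuads_le ht (U := U) (𝒬 := {Q ∈ 𝒬 | ∃ w ∈ Q, #(soleSet G U Q w) ≤ 6})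
    fun Q hQ => ⟨h𝒬 Q (mem_filter.1 hQ).1, (mem_filter.1 hQ).2⟩
  have h2 := card_goodQuads_le ht (U := U) (𝒬 := {Q ∈ 𝒬 | ¬ ∃ w ∈ Q, #(soleSet G U Q w) ≤ 6})
    fun Q hQ => ⟨h𝒬 Q (mem_filter.1 hQ).1, by simpa using (mem_filter.1 hQ).2⟩
  have h3 := card_filter_add_card_filter_not (s := 𝒬) (fun Q => ∃ w ∈ Q, #(soleSet G U Q w) ≤ 6)
  omega

lemma exists_eq_triple {S : Finset V} (hne : S.Nonempty) (hc : #S ≤ 3) :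
    ∃ x y z, S = {x, y, z} := by
  have : #S = 1 ∨ #S = 2 ∨ #S = 3 := by have := card_pos.2 hne; omega
  rcases this with h | h | h
  · obtain ⟨x, rfl⟩ := card_eq_one.1 h
    exact ⟨x, x, x, by simp⟩
  · obtain ⟨x, y, -, rfl⟩ := card_eq_two.1 h
    exact ⟨x, y, y, by simp⟩
  · obtain ⟨x, y, z, -, -, -, rfl⟩ := card_eq_three.1 h
    exact ⟨x, y, z, rfl⟩

lemma card_filter_adj_comm (S T : Finset V) :
    ∑ s ∈ S, #{t ∈ T | G.Adj s t} = ∑ t ∈ T, #{s ∈ S | G.Adj t s} := by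
  refine (sum_card_bipartiteAbove_eq_sum_card_bipartiteBelow G.Adj).trans ?_
  refine sum_congr rfl fun t _ => ?_
  simp only [bipartiteBelow, G.adj_comm]

/-- The neighbours of `v` in `A`. -/
noncomputable def trace (G : SimpleGraph V) (A : Finset V) (v : V) : Finset V := {a ∈ A | G.Adj v a}

lemma mem_trace {A : Finset V} {v a : V} : a ∈ trace G A v ↔ a ∈ A ∧ G.Adj v a := by
  simp [trace]

/-- The vertices of `L` all of whose neighbours lie in `A ∪ L`. -/
noncomputable def inner (G : SimpleGraph V) (A L : Finset V) : Finset V :=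
  {v ∈ L | ∀ w, G.Adj v w → w ∈ A ∨ w ∈ L}

lemma mem_inner {A L : Finset V} {v : V} :
    v ∈ inner G A L ↔ v ∈ L ∧ ∀ w, G.Adj v w → w ∈ A ∨ w ∈ L := by
  rw [inner, mem_filter]

lemma inner_subset {A L : Finset V} : inner G A L ⊆ L := filter_subset _ _

/-- The inner vertices with at most five neighbours in `A`. -/
noncomputable def light (G : SimpleGraph V) (A L : Finset V) : Finset V :=
  {v ∈ inner G A L | #(trace G A v) ≤ 5}

lemma light_subset {A L : Finset V} : light G A L ⊆ inner G A L := filter_subset _ _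

/-- A triangle-free, twin-free graph of diameter two with disjoint vertex sets `A` and `L`, the
vertices of `L` having degree at most `D`. -/
structure Split [Fintype V] (G : SimpleGraph V) (A L : Finset V) (D : ℕ) : Prop where
  noTriangle : NoTriangle G
  common : ∀ u v, u ≠ v → ¬ G.Adj u v → ∃ w, G.Adj u w ∧ G.Adj v w
  twinFree : ∀ u v, (∀ w, G.Adj u w ↔ G.Adj v w) → u = v
  disj : ∀ v ∈ A, v ∉ L
  deg : ∀ v ∈ L, #{w | G.Adj v w} ≤ D

/-- A bound for the number of vertices that the trace of an inner vertex fails to dominate. -/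
def missBound (D : ℕ) : ℕ := 1 + D + D * D

/-- A bound for the number of inner vertices with the same trace. -/
def multBound (D : ℕ) : ℕ := missBound D * D + 1

/-- A bound for the number of light vertices containing a fixed set and at most three further
vertices in their trace. -/
def linkBound (D a : ℕ) : ℕ := 60 * missBound D * missBound D * a * multBound D

/-- A bound for the number of light vertices with small trace. -/
def fewBound (D a : ℕ) : ℕ := 6 * missBound D + 25 * linkBound D a

namespace Split

variable [Fintype V] {A L : Finset V} {D : ℕ}

lemma card_undominated_le (h : Split G A L D) {v : V} (hv : v ∈ inner G A L) :
    #{u | ∀ t ∈ trace G A v, ¬ G.Adj t u} ≤ missBound D := by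
  rw [mem_inner] at hv
  have hsub : ({u | ∀ t ∈ trace G A v, ¬ G.Adj t u} : Finset V) ⊆
      {v} ∪ ({u | G.Adj v u} : Finset V) ∪
      ({w | G.Adj v w ∧ w ∈ L} : Finset V).biUnion fun w => {u | G.Adj w u} := by
    intro u hu
    simp only [mem_filter, mem_univ, true_and, mem_union, mem_singleton, mem_biUnion] at hu ⊢
    by_cases h1 : u = v
    · exact Or.inl (Or.inl h1)
    by_cases h2 : G.Adj v u
    · exact Or.inl (Or.inr h2)
    obtain ⟨w, hw1, hw2⟩ := h.common u v h1 (fun e => h2 e.symm)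
    refine Or.inr ⟨w, ⟨hw2, (hv.2 w hw2).resolve_left fun hA => ?_⟩, hw1.symm⟩
    exact hu w (mem_trace.2 ⟨hA, hw2⟩) hw1.symm
  refine (card_le_card hsub).trans ((card_union_le _ _).trans (add_le_add
    ((card_union_le _ _).trans (add_le_add (by simp) (h.deg v hv.1))) ?_))
  refine (card_biUnion_le_card_mul _ _ D fun w hw => ?_).trans (Nat.mul_le_mul_right D
    ((card_le_card ?_).trans (h.deg v hv.1)))
  · simp only [mem_filter] at hw
    exact h.deg w hw.2.2
  · intro w
    simp only [mem_filter]
    tauto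

lemma card_fiber_le (h : Split G A L D) (S : Finset V) :
    #{v ∈ inner G A L | trace G A v = S} ≤ multBound D := by
  set M := {v ∈ inner G A L | trace G A v = S} with hM
  rcases M.eq_empty_or_nonempty with he | ⟨v0, hv0⟩
  · simp [he]
  rw [hM, mem_filter] at hv0
  have hc := h.card_undominated_le hv0.1
  rw [hv0.2] at hc
  have hsub : M ⊆ (({u | ∀ t ∈ S, ¬ G.Adj t u} : Finset V).filter (· ∈ L)).biUnion
      (fun u => {v | G.Adj u v}) ∪ {v ∈ M | ∀ w, G.Adj v w → w ∈ A} := by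
    intro v hv
    rw [mem_union, or_iff_not_imp_right]
    intro hnot
    have hv' := hv
    rw [hM, mem_filter] at hv'
    simp only [mem_filter, hv, true_and, not_forall] at hnot
    obtain ⟨w, hw, hwA⟩ := hnot
    have hwL : w ∈ L := ((mem_inner.1 hv'.1).2 w hw).resolve_left hwA
    simp only [mem_biUnion, mem_filter, mem_univ, true_and]
    refine ⟨w, ⟨fun t ht htw => ?_, hwL⟩, hw.symm⟩
    rw [← hv'.2, mem_trace] at ht
    exact h.noTriangle ht.2 htw hw
  have h1 : #{v ∈ M | ∀ w, G.Adj v w → w ∈ A} ≤ 1 := by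
    rw [card_le_one]
    intro a ha b hb
    simp only [hM, mem_filter] at ha hb
    refine h.twinFree a b fun w => ?_
    have h1 : w ∈ trace G A a ↔ w ∈ trace G A b := by rw [ha.1.2, hb.1.2]
    rw [mem_trace, mem_trace] at h1
    have := ha.2 w
    have := hb.2 w
    tauto
  refine (card_le_card hsub).trans ((card_union_le _ _).trans (add_le_add ?_ h1))
  refine (card_biUnion_le_card_mul _ _ D fun w hw => h.deg w (mem_filter.1 hw).2).trans ?_
  exact Nat.mul_le_mul_right D ((card_filter_le _ _).trans hc)

lemma card_disjoint_le (h : Split G A L D) {v : V} (hv : v ∈ inner G A L) :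
    #{v' ∈ inner G A L | ∀ t ∈ trace G A v, t ∉ trace G A v'} ≤ missBound D := by
  refine (card_le_card fun u hu => ?_).trans (h.card_undominated_le hv)
  simp only [mem_filter, mem_univ, true_and] at hu ⊢
  exact fun t ht htu => hu.2 t ht (mem_trace.2 ⟨(mem_trace.1 ht).1, htu.symm⟩)

lemma trace_nadj (h : Split G A L D) {v x y : V} (hx : x ∈ trace G A v) (hy : y ∈ trace G A v) :
    ¬ G.Adj x y := fun e => h.noTriangle (mem_trace.1 hx).2 e (mem_trace.1 hy).2

lemma card_link_le (h : Split G A L D) {P : Finset V} (hP : P.Nonempty) :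
    #{v ∈ inner G A L | P ⊆ trace G A v ∧ #(trace G A v \ P) ≤ 3} ≤ linkBound D #A := by
  set Y := {v ∈ inner G A L | P ⊆ trace G A v ∧ #(trace G A v \ P) ≤ 3} with hY
  set U := {u ∈ A | ∀ p ∈ P, ¬ G.Adj p u} with hU
  set 𝒯 := {p ∈ U ×ˢ U ×ˢ U | AlmostDom G U (missBound D) p.1 p.2.1 p.2.2} with h𝒯
  have himg : Y.image (trace G A) ⊆ 𝒯.image fun p => P ∪ {p.1, p.2.1, p.2.2} := by
    intro S hS
    obtain ⟨v, hv, rfl⟩ := mem_image.1 hS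
    rw [hY, mem_filter] at hv
    obtain ⟨hv, hPv, hc⟩ := hv
    obtain ⟨x, y, z, hS⟩ : ∃ x y z, trace G A v = P ∪ {x, y, z} := by
      rcases (trace G A v \ P).eq_empty_or_nonempty with he | hne
      · obtain ⟨p, hp⟩ := hP
        refine ⟨p, p, p, ?_⟩
        rw [sdiff_eq_empty_iff_subset] at he
        rw [he.antisymm hPv]
        simp [hp]
      · obtain ⟨x, y, z, hxyz⟩ := exists_eq_triple hne hc
        exact ⟨x, y, z, by rw [← hxyz, union_sdiff_of_subset hPv]⟩
    have hx : x ∈ trace G A v := by rw [hS]; simp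
    have hy : y ∈ trace G A v := by rw [hS]; simp
    have hz : z ∈ trace G A v := by rw [hS]; simp
    have hmU : ∀ x ∈ trace G A v, x ∈ U := fun x hx =>
      mem_filter.2 ⟨(mem_trace.1 hx).1, fun p hp => h.trace_nadj (hPv hp) hx⟩
    refine mem_image.2 ⟨(x, y, z), ?_, hS.symm⟩
    simp only [h𝒯, mem_filter, mem_product]
    refine ⟨⟨hmU x hx, hmU y hy, hmU z hz⟩, hmU x hx, hmU y hy, hmU z hz, h.trace_nadj hx hy,
      h.trace_nadj hx hz, h.trace_nadj hy hz, (card_le_card fun u hu => ?_).trans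
        (h.card_undominated_le hv)⟩
    rw [hS]
    simp only [hU, mem_filter, mem_univ, true_and, mem_union, mem_insert, mem_singleton] at hu ⊢
    rintro t (ht | rfl | rfl | rfl)
    exacts [hu.1.2 t ht, hu.2.1, hu.2.2.1, hu.2.2.2]
  have h1 : #Y ≤ multBound D * #(Y.image (trace G A)) := by
    refine card_le_mul_card_image _ _ fun S _ => (card_le_card ?_).trans (h.card_fiber_le S)
    intro v
    simp only [hY, mem_filter]
    tauto
  have h2 : #𝒯 ≤ 60 * missBound D * missBound D * #U := card_almostDom_le h.noTriangle U _
  have h3 : #U ≤ #A := card_filter_le _ _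
  calc #Y ≤ multBound D * #(Y.image (trace G A)) := h1
    _ ≤ multBound D * (60 * missBound D * missBound D * #A) :=
        Nat.mul_le_mul_left _ (((card_le_card himg).trans card_image_le).trans
          (h2.trans (Nat.mul_le_mul_left _ h3)))
    _ = linkBound D #A := by rw [linkBound, mul_comm]

lemma card_light_small_le (h : Split G A L D) :
    #{v ∈ light G A L | #(trace G A v) ≤ 4} ≤ fewBound D #A := by
  rcases (light G A L).eq_empty_or_nonempty with he | ⟨v0, hv0⟩
  · simp [he]
  rw [light, mem_filter] at hv0
  have hsub : {v ∈ light G A L | #(trace G A v) ≤ 4} ⊆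
      {v' ∈ inner G A L | ∀ t ∈ trace G A v0, t ∉ trace G A v'} ∪ (trace G A v0).biUnion fun k =>
        {v ∈ inner G A L | {k} ⊆ trace G A v ∧ #(trace G A v \ {k}) ≤ 3} := by
    intro v hv
    simp only [light, mem_filter, mem_union, mem_biUnion, singleton_subset_iff] at hv ⊢
    by_cases hd : ∀ t ∈ trace G A v0, t ∉ trace G A v
    · exact Or.inl ⟨hv.1.1, hd⟩
    · push Not at hd
      obtain ⟨k, hk0, hk⟩ := hd
      refine Or.inr ⟨k, hk0, hv.1.1, hk, ?_⟩
      have := card_sdiff_add_card_inter (trace G A v) {k}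
      rw [inter_singleton_of_mem hk, card_singleton] at this
      omega
  have h1 := (card_le_card hsub).trans (card_union_le _ _)
  have h2 := h.card_disjoint_le hv0.1
  have h3 := card_biUnion_le_card_mul (trace G A v0) (fun k =>
    {v ∈ inner G A L | {k} ⊆ trace G A v ∧ #(trace G A v \ {k}) ≤ 3}) (linkBound D #A)
    fun k _ => h.card_link_le (singleton_nonempty k)
  have h4 : #(trace G A v0) * linkBound D #A ≤ 5 * linkBound D #A := Nat.mul_le_mul_right _ hv0.2
  rw [fewBound]
  omega

lemma card_mem_trace_le (h : Split G A L D) {v k : V} (hv : v ∈ light G A L)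
    (hk : k ∉ trace G A v) :
    #{v' ∈ light G A L | k ∈ trace G A v'} ≤ missBound D + 5 * linkBound D #A := by
  rw [light, mem_filter] at hv
  have hsub : {v' ∈ light G A L | k ∈ trace G A v'} ⊆
      {v' ∈ inner G A L | ∀ t ∈ trace G A v, t ∉ trace G A v'} ∪ (trace G A v).biUnion fun y =>
        {v ∈ inner G A L | {k, y} ⊆ trace G A v ∧ #(trace G A v \ {k, y}) ≤ 3} := by
    intro v' hv'
    simp only [light, mem_filter, mem_union, mem_biUnion] at hv' ⊢
    by_cases hd : ∀ t ∈ trace G A v, t ∉ trace G A v'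
    · exact Or.inl ⟨hv'.1.1, hd⟩
    · push Not at hd
      obtain ⟨y, hy0, hy⟩ := hd
      have hky : k ≠ y := fun e => hk (e ▸ hy0)
      have hs : {k, y} ⊆ trace G A v' := by
        simp [insert_subset_iff, hv'.2, hy]
      refine Or.inr ⟨y, hy0, hv'.1.1, hs, ?_⟩
      rw [card_sdiff_of_subset hs, card_pair hky]
      omega
  have h1 := (card_le_card hsub).trans (card_union_le _ _)
  have h2 := h.card_disjoint_le hv.1
  have h3 := card_biUnion_le_card_mul (trace G A v) (fun y =>
    {v ∈ inner G A L | {k, y} ⊆ trace G A v ∧ #(trace G A v \ {k, y}) ≤ 3}) (linkBound D #A)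
    fun y _ => h.card_link_le (insert_nonempty k {y})
  have h4 : #(trace G A v) * linkBound D #A ≤ 5 * linkBound D #A := Nat.mul_le_mul_right _ hv.2
  omega

/-- Either there are few light vertices or all of them have a common neighbour. -/
lemma card_light_le_or (h : Split G A L D) :
    #(light G A L) ≤ fewBound D #A ∨ ∃ k, ∀ v ∈ light G A L, k ∈ trace G A v := by
  rw [or_iff_not_imp_right]
  intro hk
  push Not at hk
  rcases (light G A L).eq_empty_or_nonempty with he | ⟨v0, hv0⟩
  · simp [he]
  have hv0' := hv0
  rw [light, mem_filter] at hv0'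
  have hsub : light G A L ⊆ {v' ∈ inner G A L | ∀ t ∈ trace G A v0, t ∉ trace G A v'} ∪
      (trace G A v0).biUnion fun k => {v' ∈ light G A L | k ∈ trace G A v'} := by
    intro v hv
    simp only [mem_filter, mem_union, mem_biUnion]
    by_cases hd : ∀ t ∈ trace G A v0, t ∉ trace G A v
    · exact Or.inl ⟨light_subset hv, hd⟩
    · push Not at hd
      obtain ⟨k, hk0, hk⟩ := hd
      exact Or.inr ⟨k, hk0, hv, hk⟩
  have h1 := (card_le_card hsub).trans (card_union_le _ _)
  have h2 := h.card_disjoint_le hv0'.1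
  have h3 := card_biUnion_le_card_mul (trace G A v0) (fun k =>
    {v' ∈ light G A L | k ∈ trace G A v'}) (missBound D + 5 * linkBound D #A) fun k _ => by
      obtain ⟨v, hv, hkv⟩ := hk k
      exact h.card_mem_trace_le hv hkv
  have h4 : #(trace G A v0) * (missBound D + 5 * linkBound D #A) ≤
    5 * (missBound D + 5 * linkBound D #A) := Nat.mul_le_mul_right _ hv0'.2
  rw [fewBound]
  omega

lemma card_quads_le (h : Split G A L D) {k : V} (hk : ∀ v ∈ light G A L, k ∈ trace G A v) :
    4 * #{v ∈ light G A L | #(trace G A v) = 5 ∧ ∀ w, G.Adj v w → w ∈ A} ≤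
      3 * ∑ a ∈ A, #{b ∈ A | G.Adj a b} + 51846 * #A := by
  set N := {v ∈ light G A L | #(trace G A v) = 5 ∧ ∀ w, G.Adj v w → w ∈ A} with hN
  set U := {u ∈ A | u ≠ k ∧ ¬ G.Adj k u} with hU
  have hUA : U ⊆ A := filter_subset _ _
  have hmem : ∀ v ∈ N, v ∈ light G A L ∧ #(trace G A v) = 5 ∧ ∀ w, G.Adj v w → w ∈ A := by
    intro v hv
    rwa [hN, mem_filter] at hv
  have hinj : Set.InjOn (fun v => (trace G A v).erase k) N := by
    intro v hv v' hv' he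
    have hv := hmem v hv
    have hv' := hmem v' hv'
    have he' : trace G A v = trace G A v' := by
      rw [← insert_erase (hk v hv.1), ← insert_erase (hk v' hv'.1)]
      exact congrArg _ he
    refine h.twinFree v v' fun w => ?_
    have h1 : w ∈ trace G A v ↔ w ∈ trace G A v' := by rw [he']
    rw [mem_trace, mem_trace] at h1
    have := hv.2.2 w
    have := hv'.2.2 w
    tauto
  have hdq : ∀ Q ∈ N.image (fun v => (trace G A v).erase k), DomQuad G U Q := by
    intro Q hQ
    obtain ⟨v, hv, rfl⟩ := mem_image.1 hQ
    have hv := hmem v hv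
    have hkv := hk v hv.1
    constructor
    · intro u hu
      rw [mem_erase] at hu
      exact mem_filter.2 ⟨(mem_trace.1 hu.2).1, hu.1, h.trace_nadj hkv hu.2⟩
    · rw [card_erase_of_mem hkv, hv.2.1]
    · exact fun x hx y hy => h.trace_nadj (mem_of_mem_erase hx) (mem_of_mem_erase hy)
    · intro u hu hnot
      rw [hU, mem_filter] at hu
      have hvu : ¬ G.Adj v u := fun e => hnot (mem_erase.2 ⟨hu.2.1, mem_trace.2 ⟨hu.1, e⟩⟩)
      have hne : v ≠ u := by
        rintro rfl
        exact h.disj v hu.1 (inner_subset (light_subset hv.1))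
      obtain ⟨w, hw1, hw2⟩ := h.common v u hne hvu
      refine ⟨w, mem_erase.2 ⟨?_, mem_trace.2 ⟨hv.2.2 w hw1, hw1⟩⟩, hw2.symm⟩
      rintro rfl
      exact hu.2.2 hw2.symm
  have h1 := card_domQuads_le h.noTriangle hdq
  rw [card_image_of_injOn hinj] at h1
  have h2 : ∑ x ∈ U, #{u ∈ U | G.Adj x u} ≤ ∑ a ∈ A, #{b ∈ A | G.Adj a b} :=
    (sum_le_sum fun x _ => card_le_card (filter_subset_filter _ hUA)).trans
      (sum_le_sum_of_subset hUA)
  have h3 := card_le_card hUA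
  omega

lemma le_sum_degrees (h : Split G A L D) {X : Finset V} (hXB : X ⊆ inner G A L)
    (hX : ∀ u ∈ X, ∀ v ∈ X, ¬ G.Adj u v) :
    ∑ a ∈ A, #{b ∈ A | G.Adj a b} + ∑ v ∈ inner G A L, 2 * #(trace G A v) +
      ∑ v ∈ X, 2 * #{w ∈ L | G.Adj v w} ≤ ∑ v, #{w | G.Adj v w} := by
  set B := inner G A L with hB
  have hBL : B ⊆ L := inner_subset
  have hdisj : ∀ v ∈ A, v ∉ L := h.disj
  have s1 : ∑ a ∈ A, #{b ∈ A | G.Adj a b} + ∑ a ∈ A, #{b ∈ B | G.Adj a b} ≤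
      ∑ a ∈ A, #{w | G.Adj a w} := by
    rw [← sum_add_distrib]
    refine sum_le_sum fun a _ => ?_
    rw [← card_union_of_disjoint]
    · exact card_le_card fun u => by simp only [mem_union, mem_filter, mem_univ]; tauto
    · rw [Finset.disjoint_left]
      intro u hu hu'
      exact hdisj u (mem_filter.1 hu).1 (hBL (mem_filter.1 hu').1)
  have s2 : ∑ a ∈ A, #{b ∈ B | G.Adj a b} = ∑ v ∈ B, #(trace G A v) :=
    card_filter_adj_comm A B
  have s3 : ∑ v ∈ B \ X, #(trace G A v) + ∑ v ∈ X, #(trace G A v) = ∑ v ∈ B, #(trace G A v) :=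
    sum_sdiff hXB
  have s4 : ∑ v ∈ X, #(trace G A v) + ∑ v ∈ X, #{w ∈ L | G.Adj v w} ≤ ∑ v ∈ X, #{w | G.Adj v w} := by
    rw [← sum_add_distrib]
    refine sum_le_sum fun a _ => ?_
    rw [trace, ← card_union_of_disjoint]
    · exact card_le_card fun u => by simp only [mem_union, mem_filter, mem_univ]; tauto
    · rw [Finset.disjoint_left]
      intro u hu hu'
      exact hdisj u (mem_filter.1 hu).1 (mem_filter.1 hu').1
  have s5 : ∑ v ∈ L \ X, #(trace G A v) + ∑ v ∈ L \ X, #{w ∈ X | G.Adj v w} ≤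
      ∑ v ∈ L \ X, #{w | G.Adj v w} := by
    rw [← sum_add_distrib]
    refine sum_le_sum fun a _ => ?_
    rw [trace, ← card_union_of_disjoint]
    · exact card_le_card fun u => by simp only [mem_union, mem_filter, mem_univ]; tauto
    · rw [Finset.disjoint_left]
      intro u hu hu'
      exact hdisj u (mem_filter.1 hu).1 (hBL (hXB (mem_filter.1 hu').1))
  have s6 : ∑ v ∈ L \ X, #{w ∈ X | G.Adj v w} = ∑ v ∈ X, #{w ∈ L | G.Adj v w} := by
    rw [card_filter_adj_comm]
    refine sum_congr rfl fun v hv => congrArg card ?_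
    ext w
    simp only [mem_filter, mem_sdiff]
    have := fun hw => hX v hv w hw
    tauto
  have s7 : ∑ v ∈ B \ X, #(trace G A v) ≤ ∑ v ∈ L \ X, #(trace G A v) :=
    sum_le_sum_of_subset (sdiff_subset_sdiff hBL le_rfl)
  have s8 : ∑ a ∈ A, #{w | G.Adj a w} + (∑ v ∈ L \ X, #{w | G.Adj v w} +
      ∑ v ∈ X, #{w | G.Adj v w}) ≤ ∑ v, #{w | G.Adj v w} := by
    rw [sum_sdiff (hXB.trans hBL), ← sum_union (Finset.disjoint_left.2 hdisj)]
    exact sum_le_sum_of_subset (subset_univ _)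
  rw [← mul_sum, ← mul_sum]
  omega

/-- The edge count of a split graph in terms of its inner vertices. -/
theorem card_inner_le (h : Split G A L D) :
    34 * #(inner G A L) ≤ 3 * ∑ v, #{w | G.Adj v w} + 51846 * #A + 36 * fewBound D #A := by
  set B := inner G A L with hB
  set X := light G A L with hX
  have hXB : X ⊆ B := light_subset
  have hBX : ∀ v ∈ B, v ∉ X → 6 ≤ #(trace G A v) := by
    intro v hv hvX
    by_contra hlt
    exact hvX (mem_filter.2 ⟨hv, by omega⟩)
  rcases h.card_light_le_or with hc | ⟨k, hk⟩
  · have h1 := h.le_sum_degrees (empty_subset _) (by simp)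
    rw [← hB] at h1
    rw [← hX] at hc
    have h2 : ∑ v ∈ B, 12 ≤ ∑ v ∈ B, (2 * #(trace G A v) + if v ∈ X then 12 else 0) := by
      refine sum_le_sum fun v hv => ?_
      split_ifs with hvX
      · omega
      · have := hBX v hv hvX
        omega
    rw [sum_add_distrib, ← sum_filter, filter_mem_eq_inter, inter_eq_right.2 hXB, sum_const,
      sum_const, smul_eq_mul, smul_eq_mul] at h2
    omega
  · have hind : ∀ u ∈ X, ∀ v ∈ X, ¬ G.Adj u v := fun u hu v hv e =>
      h.noTriangle (mem_trace.1 (hk u hu)).2.symm e (mem_trace.1 (hk v hv)).2.symm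
    have h1 := h.le_sum_degrees hXB hind
    rw [← hB] at h1
    have h2 := h.card_quads_le hk
    have h3 := h.card_light_small_le
    set N := {v ∈ X | #(trace G A v) = 5 ∧ ∀ w, G.Adj v w → w ∈ A} with hN
    set S := {v ∈ X | #(trace G A v) ≤ 4} with hS
    have h4 : ∑ v ∈ B, 12 ≤ ∑ v ∈ B, (2 * #(trace G A v) +
        ((if v ∈ X then 2 * #{w ∈ L | G.Adj v w} else 0) +
          ((if v ∈ N then 2 else 0) + if v ∈ S then 12 else 0))) := by
      refine sum_le_sum fun v hv => ?_
      by_cases hvX : v ∈ X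
      · by_cases hvS : #(trace G A v) ≤ 4
        · rw [if_pos (show v ∈ S from mem_filter.2 ⟨hvX, hvS⟩)]
          omega
        · have h5 : #(trace G A v) = 5 := by
            have := (mem_filter.1 hvX).2
            omega
          by_cases hA : ∀ w, G.Adj v w → w ∈ A
          · rw [if_pos (show v ∈ N from mem_filter.2 ⟨hvX, h5, hA⟩)]
            omega
          · push Not at hA
            obtain ⟨w, hw, hwA⟩ := hA
            have hwL := ((mem_inner.1 hv).2 w hw).resolve_left hwA
            have : 0 < #{w ∈ L | G.Adj v w} := card_pos.2 ⟨w, mem_filter.2 ⟨hwL, hw⟩⟩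
            rw [if_pos hvX]
            omega
      · have := hBX v hv hvX
        omega
    have hNB : N ⊆ B := (filter_subset _ _).trans hXB
    have hSB : S ⊆ B := (filter_subset _ _).trans hXB
    rw [sum_add_distrib, sum_add_distrib, sum_add_distrib, ← sum_filter, ← sum_filter, ← sum_filter,
      filter_mem_eq_inter, filter_mem_eq_inter, filter_mem_eq_inter, inter_eq_right.2 hXB,
      inter_eq_right.2 hNB, inter_eq_right.2 hSB, sum_const, sum_const, sum_const, smul_eq_mul,
      smul_eq_mul, smul_eq_mul] at h4
    have h5 := card_le_card hNB
    omega

end Split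

lemma cliqueFree_three_iff : G.CliqueFree 3 ↔ NoTriangle G := by
  constructor
  · intro h a b c hab hbc hac
    exact h {a, b, c} (is3Clique_triple_iff.2 ⟨hab, hac, hbc⟩)
  · intro h s hs
    obtain ⟨a, b, c, hab, hac, hbc, -⟩ := is3Clique_iff.1 hs
    exact h hab hbc hac

lemma ksat_three_iff : Ksat 3 G ↔
    NoTriangle G ∧ ∀ u v, u ≠ v → ¬ G.Adj u v → ∃ w, G.Adj u w ∧ G.Adj v w := by
  rw [Ksat, cliqueFree_three_iff]
  refine and_congr_right fun ht => forall₄_congr fun u v hne hadj => ?_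
  rw [cliqueFree_three_iff]
  constructor
  · intro h
    simp only [NoTriangle, sup_adj, fromEdgeSet_adj, Set.mem_singleton_iff, not_forall,
      not_not] at h
    obtain ⟨a, b, c, hab, hbc, hac⟩ := h
    simp only [Sym2.eq_iff] at hab hbc hac
    have := @ht a b c
    have hl : ∀ a, ¬ G.Adj a a := fun a => G.irrefl
    grind [G.adj_comm]
  · rintro ⟨w, h1, h2⟩ h
    have e1 : (G ⊔ fromEdgeSet {s(u, v)}).Adj u w := Or.inl h1
    have e2 : (G ⊔ fromEdgeSet {s(u, v)}).Adj w v := Or.inl h2.symm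
    exact h e1 e2 (Or.inr (by simp [hne]))

/-- The constant of the error term in the edge bound for split graphs. -/
def splitConst (D : ℕ) : ℕ :=
  51880 + 216 * missBound D + 900 * (60 * missBound D * missBound D * multBound D)

lemma card_inner_add_le [Fintype V] {A L : Finset V} {D : ℕ} (h : Split G A L D) :
    34 * (#(inner G A L) + #A) ≤ 3 * ∑ v, #{w | G.Adj v w} + splitConst D * #A + splitConst D := by
  have h1 := h.card_inner_le
  have h2 : 36 * fewBound D #A = 216 * missBound D +
      900 * (60 * missBound D * missBound D * multBound D) * #A := by
    rw [fewBound, linkBound]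
    ring
  have h3 : splitConst D * #A = 51880 * #A + 216 * missBound D * #A +
      900 * (60 * missBound D * missBound D * multBound D) * #A := by
    rw [splitConst]
    ring
  have h4 : 216 * missBound D ≤ splitConst D := by
    rw [splitConst]
    omega
  have h5 : 0 ≤ 216 * missBound D * #A := Nat.zero_le _
  omega

lemma exists_thresholds {δ : ℝ} (hδ : 0 < δ) : ∃ d : ℕ → ℕ, Monotone d ∧
    ∀ i, (splitConst (d i) : ℝ) * 12 ≤ δ * d (i + 1) := by
  refine ⟨fun i => Nat.rec 0 (fun _ a => a + ⌈(splitConst a : ℝ) * 12 / δ⌉₊) i,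
    monotone_nat_of_le_succ fun i => Nat.le_add_right _ _, fun i => ?_⟩
  simp only
  generalize (Nat.rec 0 (fun _ a => a + ⌈(splitConst a : ℝ) * 12 / δ⌉₊) i : ℕ) = a
  have h := Nat.le_ceil ((splitConst a : ℝ) * 12 / δ)
  rw [div_le_iff₀ hδ] at h
  push_cast
  nlinarith [Nat.cast_nonneg (α := ℝ) a]

lemma sum_bands_le [Fintype V] (f : V → ℕ) {d : ℕ → ℕ} (hd : Monotone d) (J : ℕ) :
    ∑ i ∈ range J, ∑ v with d i < f v ∧ f v ≤ d (i + 1), f v ≤ ∑ v with f v ≤ d J, f v := by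
  induction J with
  | zero => simp
  | succ J ih =>
    rw [sum_range_succ]
    refine (Nat.add_le_add_right ih _).trans ?_
    rw [← sum_union]
    · refine sum_le_sum_of_subset fun v => ?_
      have := hd (Nat.le_succ J)
      simp only [mem_union, mem_filter, mem_univ, true_and, Nat.succ_eq_add_one] at *
      omega
    · rw [Finset.disjoint_left]
      intro v
      simp only [mem_filter, mem_univ, true_and]
      omega

/-- The lower bound: a twin-free saturated graph has at least `(17/3 - ε) n` edges. -/
theorem lower_bound {ε : ℝ} (hε : 0 < ε) : ∃ N : ℕ, ∀ (V : Type) [Fintype V] (G : SimpleGraph V),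
    N ≤ Fintype.card V → Ksat 3 G → TwinFree G →
      ((17 : ℝ) / 3 - ε) * Fintype.card V ≤ (G.edgeSet.ncard : ℝ) := by
  obtain ⟨δ, hδ, hδε⟩ : ∃ δ : ℝ, 0 < δ ∧ 70 * δ = 6 * ε := ⟨6 * ε / 70, by positivity, by ring⟩
  obtain ⟨d, hd, hdC⟩ := exists_thresholds hδ
  obtain ⟨J, hJ⟩ := exists_nat_gt (12 / δ)
  rw [div_lt_iff₀ hδ] at hJ
  refine ⟨⌈(∑ i ∈ range J, (splitConst (d i) : ℝ)) / δ⌉₊, fun V _ G hN hK hT => ?_⟩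
  obtain ⟨ht, hc⟩ := ksat_three_iff.1 hK
  set n := Fintype.card V with hn
  set f : V → ℕ := fun v => #{w | G.Adj v w} with hf
  have hsum : ∑ v, f v = 2 * G.edgeSet.ncard := by
    rw [Set.ncard_eq_toFinset_card']
    refine Eq.trans (sum_congr rfl fun v _ => ?_) G.sum_degrees_eq_twice_card_edges
    rw [hf, ← card_neighborFinset_eq_degree, neighborFinset_eq_filter]
  have hsumR : ((∑ v, f v : ℕ) : ℝ) = 2 * G.edgeSet.ncard := by exact_mod_cast hsum
  by_cases hbig : 12 * n ≤ ∑ v, f v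
  · have : (12 * n : ℝ) ≤ ((∑ v, f v : ℕ) : ℝ) := by exact_mod_cast hbig
    have : (0 : ℝ) ≤ n := by positivity
    nlinarith
  push Not at hbig
  obtain ⟨i, hi, hband⟩ : ∃ i ∈ range J,
      ((∑ v with d i < f v ∧ f v ≤ d (i + 1), f v : ℕ) : ℝ) ≤ δ * n := by
    by_contra! hcon
    have h1 : ∑ i ∈ range J, δ * n ≤
        ∑ i ∈ range J, ((∑ v with d i < f v ∧ f v ≤ d (i + 1), f v : ℕ) : ℝ) :=
      sum_le_sum fun i hi => (hcon i hi).le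
    have h2 := sum_bands_le f hd J
    have h3 : ∑ v with f v ≤ d J, f v ≤ ∑ v, f v := sum_le_sum_of_subset (subset_univ _)
    have h4 : ∑ i ∈ range J, ((∑ v with d i < f v ∧ f v ≤ d (i + 1), f v : ℕ) : ℝ) < 12 * n := by
      exact_mod_cast (h2.trans h3).trans_lt hbig
    rw [sum_const, card_range, nsmul_eq_mul] at h1
    have : (0 : ℝ) ≤ n := by positivity
    nlinarith
  set A : Finset V := {v | d (i + 1) < f v} with hA
  set M : Finset V := {v | d i < f v ∧ f v ≤ d (i + 1)} with hM
  set L : Finset V := {v | f v ≤ d i} with hL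
  have hii : d i ≤ d (i + 1) := hd (Nat.le_succ i)
  have hsplit : Split G A L (d i) := by
    refine ⟨ht, hc, fun u v h => hT u v (Set.ext h), fun v hv hv' => ?_, fun v hv => ?_⟩
    · simp only [hA, hL, mem_filter, mem_univ, true_and] at hv hv'
      omega
    · exact (mem_filter.1 hv).2
  have hmain := card_inner_add_le hsplit
  have hcover : n ≤ #(inner G A L) + #A + 2 * ∑ v ∈ M, f v := by
    have h1 : (univ : Finset V) ⊆ (inner G A L ∪ A) ∪ (M ∪ M.biUnion fun v => {w | G.Adj v w}) := by
      intro v _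
      by_cases hvA : v ∈ A
      · simp [hvA]
      by_cases hvM : v ∈ M
      · simp [hvM]
      have hvL : v ∈ L := by
        simp only [hA, hM, hL, mem_filter, mem_univ, true_and] at *
        omega
      by_cases hvB : v ∈ inner G A L
      · simp [hvB]
      rw [mem_inner] at hvB
      push Not at hvB
      obtain ⟨w, hw, hwA, hwL⟩ := hvB hvL
      have hwM : w ∈ M := by
        simp only [hA, hM, hL, mem_filter, mem_univ, true_and] at *
        omega
      refine mem_union_right _ (mem_union_right _ (mem_biUnion.2 ⟨w, hwM, ?_⟩))
      simpa using hw.symm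
    have h2 : #M ≤ ∑ v ∈ M, f v := by
      rw [card_eq_sum_ones]
      exact sum_le_sum fun v hv => by have := (mem_filter.1 hv).2.1; omega
    have h3 : #(M.biUnion fun v => {w | G.Adj v w}) ≤ ∑ v ∈ M, f v := card_biUnion_le
    have h4 := (card_le_card h1).trans (card_union_le _ _)
    have h5 := card_union_le (inner G A L) A
    have h6 := card_union_le M (M.biUnion fun v => {w | G.Adj v w})
    rw [card_univ] at h4
    omega
  have hAcard : #A * d (i + 1) ≤ ∑ v, f v := by
    calc #A * d (i + 1) = ∑ v ∈ A, d (i + 1) := by rw [sum_const, smul_eq_mul]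
      _ ≤ ∑ v ∈ A, f v := sum_le_sum fun v hv => (mem_filter.1 hv).2.le
      _ ≤ _ := sum_le_sum_of_subset (subset_univ _)
  have hAR : (#A : ℝ) * d (i + 1) ≤ 12 * n := by exact_mod_cast hAcard.trans hbig.le
  have hCA : (splitConst (d i) : ℝ) * #A ≤ δ * n := by
    have h1 := hdC i
    have h2 : (0 : ℝ) ≤ #A := by positivity
    nlinarith
  have hCn : (splitConst (d i) : ℝ) ≤ δ * n := by
    have h1 : (∑ i ∈ range J, (splitConst (d i) : ℝ)) / δ ≤ n := (Nat.le_ceil _).trans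
      (by exact_mod_cast hN)
    rw [div_le_iff₀ hδ] at h1
    have h2 := single_le_sum (f := fun i => (splitConst (d i) : ℝ)) (fun i _ => by positivity) hi
    linarith
  have hmainR : 34 * ((#(inner G A L) : ℝ) + #A) ≤
      3 * ((∑ v, f v : ℕ) : ℝ) + splitConst (d i) * #A + splitConst (d i) := by
    exact_mod_cast hmain
  have hcoverR : (n : ℝ) ≤ #(inner G A L) + #A + 2 * ((∑ v ∈ M, f v : ℕ) : ℝ) := by
    exact_mod_cast hcover
  rw [hsumR] at hmainR
  nlinarith

end LowerBound

/-- The vertices of the graphs witnessing the upper bound. -/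
inductive Vtx (I X Y Z F : Type) where
  | k | a (i : I) | b (i : I) | x (s : X) | y (t : Y) | z (e : Z) | v (f : F)

/-- The data the construction of a sparse saturated graph is based on: `Z` is a set of cells of
`X × Y` and `F` a set of pairs from `I × Z`, both rich enough. -/
structure Design (I X Y Z F : Type) where
  fst : Z → X
  snd : Z → Y
  idx : F → I
  pt : F → Z
  ext_pt : ∀ e e', fst e = fst e' → snd e = snd e' → e = e'
  ext_fl : ∀ f f', idx f = idx f' → pt f = pt f' → f = f'
  row : ∀ i s t, ∃ f, idx f = i ∧ fst (pt f) = s ∧ snd (pt f) ≠ t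
  col : ∀ i s t, ∃ f, idx f = i ∧ fst (pt f) ≠ s ∧ snd (pt f) = t
  cov : ∀ e, ∃ f, pt f = e
  miss : ∀ i e, (∀ f, idx f = i → pt f ≠ e) → ∃ j ≠ i, ∀ f, idx f = j → pt f ≠ e
  exI : ∀ i j : I, ∃ l, l ≠ i ∧ l ≠ j
  exX : ∀ i j : X, ∃ l, l ≠ i ∧ l ≠ j
  exY : ∀ i j : Y, ∃ l, l ≠ i ∧ l ≠ j
  i₀ : I
  x₀ : X
  y₀ : Y

namespace Design

variable {I X Y Z F : Type} (P : Design I X Y Z F)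

/-- An orientation of the edges of the constructed graph. -/
def Arc : Vtx I X Y Z F → Vtx I X Y Z F → Prop
  | .v _, .k => True
  | .v f, .a i => i = P.idx f
  | .v f, .b i => i = P.idx f
  | .v f, .x s => s = P.fst (P.pt f)
  | .v f, .y t => t = P.snd (P.pt f)
  | .v f, .z e => e = P.pt f
  | .a i, .b j => i ≠ j
  | .z e, .x s => s ≠ P.fst e
  | .z e, .y t => t ≠ P.snd e
  | .z e, .a i => ∀ f, P.idx f = i → P.pt f ≠ e
  | _, _ => False

/-- The sparse saturated graph built from a design. -/
def graph : SimpleGraph (Vtx I X Y Z F) where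
  Adj u w := P.Arc u w ∨ P.Arc w u
  symm := ⟨fun _ _ h => h.symm⟩
  loopless := ⟨fun u => by cases u <;> simp [Arc]⟩

lemma adj_iff {u w : Vtx I X Y Z F} : P.graph.Adj u w ↔ P.Arc u w ∨ P.Arc w u := Iff.rfl

lemma noTriangle : NoTriangle P.graph := by
  rintro (_ | i | i | s | t | e | f) (_ | i' | i' | s' | t' | e' | f')
    (_ | j | j | s'' | t'' | e'' | f'') h1 h2 h3 <;>
  simp only [adj_iff, Arc, or_self, or_false, false_or] at h1 h2 h3 <;> grind

/-- `u` and `w` have a common neighbour. -/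
def Common (u w : Vtx I X Y Z F) : Prop := ∃ t, P.graph.Adj u t ∧ P.graph.Adj w t

variable {P}

lemma Common.symm {u w : Vtx I X Y Z F} (h : P.Common u w) : P.Common w u := by
  obtain ⟨t, h1, h2⟩ := h
  exact ⟨t, h2, h1⟩

lemma Common.of_arc (f : F) {u w : Vtx I X Y Z F} (h : P.Arc (.v f) u) (h' : P.Arc (.v f) w) :
    P.Common u w := ⟨.v f, Or.inr h, Or.inr h'⟩

variable (P)

lemma exists_arc_v (u : Vtx I X Y Z F) (hu : ∀ f, u ≠ .v f) (i : I) :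
    (∃ f, P.Arc (.v f) u) := by
  rcases u with _ | i | i | s | t | e | f
  · exact (P.row i P.x₀ P.y₀).imp fun f _ => trivial
  · exact (P.row i P.x₀ P.y₀).imp fun f h => h.1.symm
  · exact (P.row i P.x₀ P.y₀).imp fun f h => h.1.symm
  · exact (P.row i s P.y₀).imp fun f h => h.2.1.symm
  · exact (P.col i P.x₀ t).imp fun f h => h.2.2.symm
  · exact (P.cov e).imp fun f h => h.symm
  · exact absurd rfl (hu f)

lemma common_k (u : Vtx I X Y Z F) (hu : ∀ f, u ≠ .v f) : P.Common .k u := by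
  obtain ⟨f, hf⟩ := P.exists_arc_v u hu P.i₀
  exact .of_arc f trivial hf

lemma common_v (f : F) (u : Vtx I X Y Z F) (h : ¬ P.graph.Adj (.v f) u) : P.Common (.v f) u := by
  rcases u with _ | i | i | s | t | e | f'
  · exact absurd (Or.inl trivial) h
  · exact ⟨.b (P.idx f), Or.inl rfl, Or.inl fun e => h (Or.inl e)⟩
  · exact ⟨.a (P.idx f), Or.inl rfl, Or.inr fun e => h (Or.inl e.symm)⟩
  · exact ⟨.z (P.pt f), Or.inl rfl, Or.inr fun e => h (Or.inl e)⟩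
  · exact ⟨.z (P.pt f), Or.inl rfl, Or.inr fun e => h (Or.inl e)⟩
  · by_cases h1 : P.fst (P.pt f) = P.fst e
    · by_cases h2 : P.snd (P.pt f) = P.snd e
      · exact absurd (Or.inl (P.ext_pt _ _ h1 h2).symm) h
      · exact ⟨.y (P.snd (P.pt f)), Or.inl rfl, Or.inl h2⟩
    · exact ⟨.x (P.fst (P.pt f)), Or.inl rfl, Or.inl h1⟩
  · exact ⟨.k, Or.inl trivial, Or.inl trivial⟩

lemma common_ab (i j : I) (h : ¬ P.graph.Adj (.a i) (.b j)) : P.Common (.a i) (.b j) := by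
  have hij : i = j := by
    by_contra hne
    exact h (Or.inl hne)
  obtain ⟨f, hf, -⟩ := P.row i P.x₀ P.y₀
  exact .of_arc f hf.symm (hij.symm.trans hf.symm)

lemma common_az (i : I) (e : Z) (h : ¬ P.graph.Adj (.a i) (.z e)) : P.Common (.a i) (.z e) := by
  simp only [adj_iff, Arc, false_or, not_forall, not_not] at h
  obtain ⟨f, h1, h2⟩ := h
  exact .of_arc f h1.symm h2.symm

lemma common_bz (i : I) (e : Z) : P.Common (.b i) (.z e) := by
  by_cases h : ∀ f, P.idx f = i → P.pt f ≠ e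
  · obtain ⟨j, hj, hj'⟩ := P.miss i e h
    exact ⟨.a j, Or.inr hj, Or.inl hj'⟩
  · push Not at h
    obtain ⟨f, h1, h2⟩ := h
    exact .of_arc f h1.symm h2.symm

lemma common_aa (i j : I) : P.Common (.a i) (.a j) := by
  obtain ⟨l, h1, h2⟩ := P.exI i j
  exact ⟨.b l, Or.inl h1.symm, Or.inl h2.symm⟩

lemma common_bb (i j : I) : P.Common (.b i) (.b j) := by
  obtain ⟨l, h1, h2⟩ := P.exI i j
  exact ⟨.a l, Or.inr h1, Or.inr h2⟩

lemma common_ax (i : I) (s : X) : P.Common (.a i) (.x s) := by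
  obtain ⟨f, h1, h2, -⟩ := P.row i s P.y₀
  exact .of_arc f h1.symm h2.symm

lemma common_bx (i : I) (s : X) : P.Common (.b i) (.x s) := by
  obtain ⟨f, h1, h2, -⟩ := P.row i s P.y₀
  exact .of_arc f h1.symm h2.symm

lemma common_ay (i : I) (t : Y) : P.Common (.a i) (.y t) := by
  obtain ⟨f, h1, -, h2⟩ := P.col i P.x₀ t
  exact .of_arc f h1.symm h2.symm

lemma common_by (i : I) (t : Y) : P.Common (.b i) (.y t) := by
  obtain ⟨f, h1, -, h2⟩ := P.col i P.x₀ t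
  exact .of_arc f h1.symm h2.symm

lemma common_xx (s s' : X) : P.Common (.x s) (.x s') := by
  obtain ⟨l, h1, h2⟩ := P.exX s s'
  obtain ⟨f, -, rfl, -⟩ := P.row P.i₀ l P.y₀
  exact ⟨.z (P.pt f), Or.inr h1.symm, Or.inr h2.symm⟩

lemma common_yy (t t' : Y) : P.Common (.y t) (.y t') := by
  obtain ⟨l, h1, h2⟩ := P.exY t t'
  obtain ⟨f, -, -, rfl⟩ := P.col P.i₀ P.x₀ l
  exact ⟨.z (P.pt f), Or.inr h1.symm, Or.inr h2.symm⟩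

lemma common_xy (s : X) (t : Y) : P.Common (.x s) (.y t) := by
  obtain ⟨l, h1, -⟩ := P.exX s s
  obtain ⟨f, -, rfl, h2⟩ := P.row P.i₀ l t
  exact ⟨.z (P.pt f), Or.inr h1.symm, Or.inr h2.symm⟩

lemma common_xz (s : X) (e : Z) (h : ¬ P.graph.Adj (.x s) (.z e)) : P.Common (.x s) (.z e) := by
  simp only [adj_iff, Arc, false_or, not_not] at h
  obtain ⟨f, rfl⟩ := P.cov e
  exact .of_arc f h rfl

lemma common_yz (t : Y) (e : Z) (h : ¬ P.graph.Adj (.y t) (.z e)) : P.Common (.y t) (.z e) := by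
  simp only [adj_iff, Arc, false_or, not_not] at h
  obtain ⟨f, rfl⟩ := P.cov e
  exact .of_arc f h rfl

lemma common_zz (e e' : Z) : P.Common (.z e) (.z e') := by
  obtain ⟨l, h1, h2⟩ := P.exX (P.fst e) (P.fst e')
  exact ⟨.x l, Or.inl h1, Or.inl h2⟩

lemma common_of_nadj (u w : Vtx I X Y Z F) (h : ¬ P.graph.Adj u w) : P.Common u w := by
  have h' : ¬ P.graph.Adj w u := fun e => h e.symm
  rcases u with _ | i | i | s | t | e | f <;> rcases w with _ | j | j | s' | t' | e' | f' <;>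
  first
    | exact P.common_v _ _ h
    | exact (P.common_v _ _ h').symm
    | exact P.common_k _ (fun _ e => by cases e)
    | exact (P.common_k _ (fun _ e => by cases e)).symm
    | exact P.common_ab _ _ h
    | exact (P.common_ab _ _ h').symm
    | exact P.common_az _ _ h
    | exact (P.common_az _ _ h').symm
    | exact P.common_xz _ _ h
    | exact (P.common_xz _ _ h').symm
    | exact P.common_yz _ _ h
    | exact (P.common_yz _ _ h').symm
    | exact P.common_bz _ _
    | exact (P.common_bz _ _).symm
    | exact P.common_aa _ _
    | exact P.common_bb _ _
    | exact P.common_ax _ _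
    | exact (P.common_ax _ _).symm
    | exact P.common_bx _ _
    | exact (P.common_bx _ _).symm
    | exact P.common_ay _ _
    | exact (P.common_ay _ _).symm
    | exact P.common_by _ _
    | exact (P.common_by _ _).symm
    | exact P.common_xx _ _
    | exact P.common_yy _ _
    | exact P.common_xy _ _
    | exact (P.common_xy _ _).symm
    | exact P.common_zz _ _

lemma ksat_graph : Ksat 3 P.graph :=
  ksat_three_iff.2 ⟨P.noTriangle, fun u w _ h => P.common_of_nadj u w h⟩

lemma twin_v {f : F} {w : Vtx I X Y Z F} (h : ∀ c, P.graph.Adj (.v f) c ↔ P.graph.Adj w c) :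
    .v f = w := by
  have hk := h .k
  rcases w with _ | j | j | s' | t' | e' | f'
  case v =>
    have ha := h (.a (P.idx f))
    have hx := h (.x (P.fst (P.pt f)))
    have hy := h (.y (P.snd (P.pt f)))
    simp only [adj_iff, Arc, or_false, true_iff] at ha hx hy
    rw [P.ext_fl f f' ha (P.ext_pt _ _ hx hy)]
  all_goals simp [adj_iff, Arc] at hk

lemma twin_a {i : I} {w : Vtx I X Y Z F} (h : ∀ c, P.graph.Adj (.a i) c ↔ P.graph.Adj w c) :
    .a i = w := by
  obtain ⟨l, hl, -⟩ := P.exI i i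
  have hb := h (.b l)
  rcases w with _ | j | j | s' | t' | e' | f'
  case a =>
    have hj := h (.b i)
    simp only [adj_iff, Arc, or_false, ne_eq, not_true_eq_false, false_iff, not_not] at hj
    rw [hj]
  case v =>
    have hk := h .k
    simp [adj_iff, Arc] at hk
  all_goals simp [adj_iff, Arc, hl.symm] at hb

lemma twin_z {e : Z} {w : Vtx I X Y Z F} (h : ∀ c, P.graph.Adj (.z e) c ↔ P.graph.Adj w c) :
    .z e = w := by
  obtain ⟨l, hl, -⟩ := P.exX (P.fst e) (P.fst e)
  have hb := h (.x l)
  rcases w with _ | j | j | s' | t' | e' | f'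
  case z =>
    have hx := h (.x (P.fst e))
    have hy := h (.y (P.snd e))
    simp only [adj_iff, Arc, or_false, ne_eq, not_true_eq_false, false_iff, not_not] at hx hy
    rw [P.ext_pt _ _ hx hy]
  case v =>
    have hk := h .k
    simp [adj_iff, Arc] at hk
  all_goals simp [adj_iff, Arc, hl] at hb

lemma twin_b {i : I} {w : Vtx I X Y Z F} (h : ∀ c, P.graph.Adj (.b i) c ↔ P.graph.Adj w c) :
    .b i = w := by
  obtain ⟨l, hl, -⟩ := P.exI i i
  have hb := h (.a l)
  rcases w with _ | j | j | s' | t' | e' | f'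
  case b =>
    have hj := h (.a i)
    simp only [adj_iff, Arc, false_or, ne_eq, not_true_eq_false, false_iff, not_not] at hj
    rw [hj]
  case v =>
    have hk := h .k
    simp [adj_iff, Arc] at hk
  case z => exact (P.twin_z fun c => (h c).symm).symm
  all_goals simp [adj_iff, Arc, hl] at hb

lemma twin_x {s : X} {w : Vtx I X Y Z F} (h : ∀ c, P.graph.Adj (.x s) c ↔ P.graph.Adj w c) :
    .x s = w := by
  rcases w with _ | j | j | s' | t' | e' | f'
  case x =>
    obtain ⟨f, -, rfl, -⟩ := P.row P.i₀ s P.y₀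
    have hj := h (.z (P.pt f))
    simp only [adj_iff, Arc, false_or, ne_eq, not_true_eq_false, false_iff, not_not] at hj
    rw [hj]
  case y =>
    obtain ⟨f, -, hs, rfl⟩ := P.col P.i₀ s t'
    have hj := h (.z (P.pt f))
    simp [adj_iff, Arc, hs.symm] at hj
  case k =>
    obtain ⟨f, -, hs, -⟩ := P.col P.i₀ s P.y₀
    have hj := h (.z (P.pt f))
    simp [adj_iff, Arc, hs.symm] at hj
  case a => exact (P.twin_a fun c => (h c).symm).symm
  case b => exact (P.twin_b fun c => (h c).symm).symm
  case z => exact (P.twin_z fun c => (h c).symm).symm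
  case v => exact (P.twin_v fun c => (h c).symm).symm

lemma twin_y {t : Y} {w : Vtx I X Y Z F} (h : ∀ c, P.graph.Adj (.y t) c ↔ P.graph.Adj w c) :
    .y t = w := by
  rcases w with _ | j | j | s' | t' | e' | f'
  case y =>
    obtain ⟨f, -, -, rfl⟩ := P.col P.i₀ P.x₀ t
    have hj := h (.z (P.pt f))
    simp only [adj_iff, Arc, false_or, ne_eq, not_true_eq_false, false_iff, not_not] at hj
    rw [hj]
  case k =>
    obtain ⟨f, -, -, hs⟩ := P.row P.i₀ P.x₀ t
    have hj := h (.z (P.pt f))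
    simp [adj_iff, Arc, hs.symm] at hj
  case a => exact (P.twin_a fun c => (h c).symm).symm
  case b => exact (P.twin_b fun c => (h c).symm).symm
  case x => exact (P.twin_x fun c => (h c).symm).symm
  case z => exact (P.twin_z fun c => (h c).symm).symm
  case v => exact (P.twin_v fun c => (h c).symm).symm

lemma twinFree_graph : TwinFree P.graph := by
  intro u w h
  replace h : ∀ c, P.graph.Adj u c ↔ P.graph.Adj w c := fun c => by
    rw [← mem_neighborSet, h, mem_neighborSet]
  rcases u with _ | i | i | s | t | e | f
  case a => exact P.twin_a h
  case b => exact P.twin_b h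
  case x => exact P.twin_x h
  case y => exact P.twin_y h
  case z => exact P.twin_z h
  case v => exact P.twin_v h
  rcases w with _ | j | j | s' | t' | e' | f'
  case k => rfl
  case a => exact (P.twin_a fun c => (h c).symm).symm
  case b => exact (P.twin_b fun c => (h c).symm).symm
  case x => exact (P.twin_x fun c => (h c).symm).symm
  case y => exact (P.twin_y fun c => (h c).symm).symm
  case z => exact (P.twin_z fun c => (h c).symm).symm
  case v => exact (P.twin_v fun c => (h c).symm).symm

/-- An enumeration of pairs of vertices containing all edges of `P.graph`. -/
def codes : (F × Fin 6) ⊕ (I × I) ⊕ (Z × (X ⊕ Y)) ⊕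
    {p : I × Z // ∀ f, P.idx f = p.1 → P.pt f ≠ p.2} → Sym2 (Vtx I X Y Z F)
  | .inl (f, 0) => s(.v f, .k)
  | .inl (f, 1) => s(.v f, .a (P.idx f))
  | .inl (f, 2) => s(.v f, .b (P.idx f))
  | .inl (f, 3) => s(.v f, .x (P.fst (P.pt f)))
  | .inl (f, 4) => s(.v f, .y (P.snd (P.pt f)))
  | .inl (f, 5) => s(.v f, .z (P.pt f))
  | .inr (.inl (i, j)) => s(.a i, .b j)
  | .inr (.inr (.inl (e, .inl s))) => s(.z e, .x s)
  | .inr (.inr (.inl (e, .inr t))) => s(.z e, .y t)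
  | .inr (.inr (.inr p)) => s(.z p.1.2, .a p.1.1)

lemma arc_mem_range_codes {u w : Vtx I X Y Z F} (h : P.Arc u w) :
    s(u, w) ∈ Set.range P.codes := by
  rcases u with _ | i | i | s | t | e | f <;> rcases w with _ | j | j | s' | t' | e' | f' <;>
    simp only [Arc] at h
  · exact ⟨.inr (.inl (i, j)), rfl⟩
  · exact ⟨.inr (.inr (.inr ⟨(j, e), h⟩)), rfl⟩
  · exact ⟨.inr (.inr (.inl (e, .inl s'))), rfl⟩
  · exact ⟨.inr (.inr (.inl (e, .inr t'))), rfl⟩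
  · exact ⟨.inl (f, 0), rfl⟩
  · subst h; exact ⟨.inl (f, 1), rfl⟩
  · subst h; exact ⟨.inl (f, 2), rfl⟩
  · subst h; exact ⟨.inl (f, 3), rfl⟩
  · subst h; exact ⟨.inl (f, 4), rfl⟩
  · subst h; exact ⟨.inl (f, 5), rfl⟩

lemma edgeSet_subset_range_codes : P.graph.edgeSet ⊆ Set.range P.codes := by
  intro q
  induction q with | _ u w
  rintro (h | h)
  · exact P.arc_mem_range_codes h
  · rw [Sym2.eq_swap]
    exact P.arc_mem_range_codes h

lemma ncard_edgeSet_le [Fintype I] [Fintype X] [Fintype Y] [Fintype Z] [Fintype F] :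
    P.graph.edgeSet.ncard ≤ Fintype.card F * 6 + (Fintype.card I * Fintype.card I +
      (Fintype.card Z * (Fintype.card X + Fintype.card Y) +
        Nat.card {p : I × Z // ∀ f, P.idx f = p.1 → P.pt f ≠ p.2})) := by
  classical
  refine (Set.ncard_le_ncard P.edgeSet_subset_range_codes (Set.finite_range _)).trans ?_
  rw [← Nat.card_coe_set_eq]
  refine (Finite.card_range_le _).trans ?_
  simp

end Design

/-- The vertices as a sum type. -/
def vtxEquiv {I X Y Z F : Type} : Vtx I X Y Z F ≃ Unit ⊕ I ⊕ I ⊕ X ⊕ Y ⊕ Z ⊕ F where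
  toFun
    | .k => .inl ()
    | .a i => .inr (.inl i)
    | .b i => .inr (.inr (.inl i))
    | .x s => .inr (.inr (.inr (.inl s)))
    | .y t => .inr (.inr (.inr (.inr (.inl t))))
    | .z e => .inr (.inr (.inr (.inr (.inr (.inl e)))))
    | .v f => .inr (.inr (.inr (.inr (.inr (.inr f)))))
  invFun
    | .inl () => .k
    | .inr (.inl i) => .a i
    | .inr (.inr (.inl i)) => .b i
    | .inr (.inr (.inr (.inl s))) => .x s
    | .inr (.inr (.inr (.inr (.inl t)))) => .y t
    | .inr (.inr (.inr (.inr (.inr (.inl e))))) => .z e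
    | .inr (.inr (.inr (.inr (.inr (.inr f))))) => .v f
  left_inv u := by cases u <;> rfl
  right_inv u := by rcases u with _ | _ | _ | _ | _ | _ | _ <;> rfl

lemma card_vtx {I X Y Z F : Type} [Fintype I] [Fintype X] [Fintype Y] [Fintype Z] [Fintype F] :
    Nat.card (Vtx I X Y Z F) = 1 + (Fintype.card I + (Fintype.card I + (Fintype.card X +
      (Fintype.card Y + (Fintype.card Z + Fintype.card F))))) := by
  rw [Nat.card_congr vtxEquiv]
  simp

lemma ksat_of_iso {V W : Type} {G : SimpleGraph V} {H : SimpleGraph W} (φ : G ≃g H)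
    (h : Ksat 3 G) : Ksat 3 H := by
  rw [ksat_three_iff] at h ⊢
  refine ⟨fun a b c h1 h2 h3 => h.1 (φ.symm.map_adj_iff.2 h1) (φ.symm.map_adj_iff.2 h2)
    (φ.symm.map_adj_iff.2 h3), fun u v huv hn => ?_⟩
  obtain ⟨w, h1, h2⟩ := h.2 (φ.symm u) (φ.symm v) (φ.symm.injective.ne huv)
    (fun e => hn (φ.symm.map_adj_iff.1 e))
  exact ⟨φ w, by simpa using φ.map_adj_iff.2 h1, by simpa using φ.map_adj_iff.2 h2⟩

lemma twinFree_of_iso {V W : Type} {G : SimpleGraph V} {H : SimpleGraph W} (φ : G ≃g H)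
    (h : TwinFree G) : TwinFree H := by
  intro u v huv
  refine φ.symm.injective (h _ _ (Set.ext fun w => ?_))
  have := Set.ext_iff.1 huv (φ w)
  simp only [mem_neighborSet] at this ⊢
  rwa [← φ.map_adj_iff, ← φ.map_adj_iff, φ.apply_symm_apply, φ.apply_symm_apply]

lemma ncard_edgeSet_of_iso {V W : Type} {G : SimpleGraph V} {H : SimpleGraph W} (φ : G ≃g H) :
    H.edgeSet.ncard = G.edgeSet.ncard := by
  rw [← Nat.card_coe_set_eq, ← Nat.card_coe_set_eq]
  exact (Nat.card_congr φ.mapEdgeSet).symm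

lemma Design.exists_graph_fin {I X Y Z F : Type} [Fintype I] [Fintype X] [Fintype Y] [Fintype Z]
    [Fintype F] (P : Design I X Y Z F) {n : ℕ}
    (hn : n = 1 + (Fintype.card I + (Fintype.card I + (Fintype.card X +
      (Fintype.card Y + (Fintype.card Z + Fintype.card F)))))) :
    ∃ G : SimpleGraph (Fin n), Ksat 3 G ∧ TwinFree G ∧
      G.edgeSet.ncard ≤ Fintype.card F * 6 + (Fintype.card I * Fintype.card I +
        (Fintype.card Z * (Fintype.card X + Fintype.card Y) +
          Nat.card {p : I × Z // ∀ f, P.idx f = p.1 → P.pt f ≠ p.2})) := by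
  have : Finite (Vtx I X Y Z F) := .of_equiv _ vtxEquiv.symm
  let φ : Vtx I X Y Z F ≃ Fin n := Finite.equivFinOfCardEq (card_vtx.trans hn.symm)
  let ψ := Iso.map φ P.graph
  refine ⟨_, ksat_of_iso ψ P.ksat_graph, twinFree_of_iso ψ P.twinFree_graph, ?_⟩
  rw [ncard_edgeSet_of_iso ψ]
  exact P.ncard_edgeSet_le

lemma exists_ne_ne {α : Type} [Fintype α] (h : 3 ≤ Fintype.card α) (i j : α) :
    ∃ l, l ≠ i ∧ l ≠ j := by
  classical
  obtain ⟨l, -, hl⟩ := Finset.exists_mem_notMem_of_card_lt_card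
    (s := {i, j}) (t := Finset.univ) (Finset.card_le_two.trans_lt h)
  simp only [Finset.mem_insert, Finset.mem_singleton, not_or] at hl
  exact ⟨l, hl⟩

/-- The cells of a board that lie in its first two rows or columns. -/
def border (w w' : ℕ) : Finset (Fin w × Fin w') := {c | c.1.val < 2 ∨ c.2.val < 2}

lemma card_border_le (w w' : ℕ) : (border w w').card ≤ 2 * w' + 2 * w := by
  have h (m : ℕ) : ({a : Fin m | a.val < 2} : Finset (Fin m)).card ≤ 2 := by
    refine (Finset.card_le_card_of_injOn (t := Finset.range 2) (fun a => a.val) ?_ ?_).trans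
      (Finset.card_range 2).le
    · intro a ha
      simpa using ha
    · exact Fin.val_injective.injOn
  have hsub : border w w' ⊆ ({a : Fin w | a.val < 2} : Finset (Fin w)) ×ˢ Finset.univ ∪
      Finset.univ ×ˢ ({b : Fin w' | b.val < 2} : Finset (Fin w')) := by
    intro c
    simp [border]
  refine ((Finset.card_le_card hsub).trans (Finset.card_union_le _ _)).trans ?_
  rw [Finset.card_product, Finset.card_product, Finset.card_univ, Finset.card_univ,
    Fintype.card_fin, Fintype.card_fin, Nat.mul_comm w]
  exact add_le_add (Nat.mul_le_mul_right _ (h _)) (Nat.mul_le_mul_right _ (h _))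

/-- The design whose cells are those in `S` and whose pairs are all but those in `T`. -/
def boardDesign {q w w' : ℕ} (hq : 3 ≤ q) (hw : 3 ≤ w) (hw' : 3 ≤ w')
    (S : Finset (Fin w × Fin w')) (T : Finset (Fin q × S)) (hS : border w w' ⊆ S)
    (hT : ∀ p ∈ T, p.2.1 ∉ border w w' ∧ (∃ j ≠ p.1, (j, p.2) ∈ T) ∧ ∃ j, (j, p.2) ∉ T) :
    Design (Fin q) (Fin w) (Fin w') S {p : Fin q × S // p ∉ T} where
  fst e := e.1.1
  snd e := e.1.2
  idx f := f.1.1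
  pt f := f.1.2
  ext_pt e e' h h' := Subtype.ext (Prod.ext h h')
  ext_fl f f' h h' := Subtype.ext (Prod.ext h h')
  row i s t := by
    obtain ⟨y, hy, hyt⟩ : ∃ y : Fin w', y.val < 2 ∧ y ≠ t := by
      by_cases h : t.val = 0
      · exact ⟨⟨1, by omega⟩, by simp, fun e => by simp [← e] at h⟩
      · exact ⟨⟨0, by omega⟩, by simp, fun e => by simp [← e] at h⟩
    have hb : (s, y) ∈ border w w' := Finset.mem_filter.2 ⟨Finset.mem_univ _, Or.inr hy⟩
    exact ⟨⟨(i, ⟨(s, y), hS hb⟩), fun h => (hT _ h).1 hb⟩, rfl, rfl, hyt⟩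
  col i s t := by
    obtain ⟨y, hy, hys⟩ : ∃ y : Fin w, y.val < 2 ∧ y ≠ s := by
      by_cases h : s.val = 0
      · exact ⟨⟨1, by omega⟩, by simp, fun e => by simp [← e] at h⟩
      · exact ⟨⟨0, by omega⟩, by simp, fun e => by simp [← e] at h⟩
    have hb : (y, t) ∈ border w w' := Finset.mem_filter.2 ⟨Finset.mem_univ _, Or.inl hy⟩
    exact ⟨⟨(i, ⟨(y, t), hS hb⟩), fun h => (hT _ h).1 hb⟩, rfl, hys, rfl⟩
  cov e := by
    by_cases h : ((⟨0, by omega⟩ : Fin q), e) ∈ T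
    · obtain ⟨j, hj⟩ := (hT _ h).2.2
      exact ⟨⟨(j, e), hj⟩, rfl⟩
    · exact ⟨⟨_, h⟩, rfl⟩
  miss i e h := by
    have hi : (i, e) ∈ T := by
      by_contra hi
      exact h ⟨_, hi⟩ rfl rfl
    obtain ⟨j, hj, hjT⟩ := (hT _ hi).2.1
    refine ⟨j, hj, ?_⟩
    rintro ⟨⟨j', e'⟩, hf⟩ rfl rfl
    exact hf hjT
  exI := exists_ne_ne (by simpa using hq)
  exX := exists_ne_ne (by simpa using hw)
  exY := exists_ne_ne (by simpa using hw')
  i₀ := ⟨0, by omega⟩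
  x₀ := ⟨0, by omega⟩
  y₀ := ⟨0, by omega⟩

lemma exists_graph_of_params {q w w' s M n : ℕ} (hq : 3 ≤ q) (hw : 3 ≤ w) (hw' : 3 ≤ w')
    (hM : M ≠ 1) (hMq : M < q) (hs : 2 * w' + 2 * w < s) (hs' : s ≤ w * w')
    (hn : n + M = 1 + 2 * q + w + w' + s * (q + 1)) :
    ∃ G : SimpleGraph (Fin n), Ksat 3 G ∧ TwinFree G ∧
      G.edgeSet.ncard ≤ 6 * (s * q) + q * q + q + s * (w + w') := by
  classical
  obtain ⟨S, hS, -, hSs⟩ := Finset.exists_subsuperset_card_eq (Finset.subset_univ (border w w'))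
    ((card_border_le w w').trans hs.le) (by simpa using hs')
  obtain ⟨z, hzS, hz⟩ := Finset.exists_mem_notMem_of_card_lt_card
    (((card_border_le w w').trans_lt hs).trans_eq hSs.symm)
  obtain ⟨M₀, -, hM₀⟩ := Finset.exists_subset_card_eq
    (s := (Finset.univ : Finset (Fin q))) (n := M) (by simpa using hMq.le)
  let T : Finset (Fin q × S) := M₀ ×ˢ {⟨z, hzS⟩}
  have hTM : T.card = M := by simp [T, hM₀]
  have hT : ∀ p ∈ T, p.2.1 ∉ border w w' ∧ (∃ j ≠ p.1, (j, p.2) ∈ T) ∧ ∃ j, (j, p.2) ∉ T := by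
    rintro ⟨i, e⟩ hp
    obtain ⟨hi, rfl⟩ : i ∈ M₀ ∧ ⟨z, hzS⟩ = e := by simpa [T] using hp
    refine ⟨hz, ?_, ?_⟩
    · have : 0 < M₀.card := Finset.card_pos.2 ⟨i, hi⟩
      obtain ⟨j, hj, hji⟩ := Finset.exists_mem_ne (show 1 < M₀.card by omega) i
      exact ⟨j, hji, by simp [T, hj]⟩
    · obtain ⟨j, -, hj⟩ := Finset.exists_mem_notMem_of_card_lt_card
        (s := M₀) (t := Finset.univ) (by simpa [hM₀] using hMq)
      exact ⟨j, by simp [T, hj]⟩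
  let P := boardDesign hq hw hw' S T hS hT
  have hF : Fintype.card {p : Fin q × S // p ∉ T} + M = s * q := by
    have h := Fintype.card_subtype_compl (fun p : Fin q × S => p ∈ T)
    have hle : T.card ≤ Fintype.card (Fin q × S) := T.card_le_univ
    simp only [Fintype.card_coe, hTM, Fintype.card_prod, Fintype.card_fin, hSs] at h hle
    rw [h, Nat.sub_add_cancel hle, Nat.mul_comm]
  have hmiss : Nat.card {p : Fin q × S // ∀ f, P.idx f = p.1 → P.pt f ≠ p.2} ≤ q := by
    have hsub : ∀ p : {p : Fin q × S // ∀ f, P.idx f = p.1 → P.pt f ≠ p.2}, p.1 ∈ T := by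
      intro p
      by_contra h
      exact p.2 ⟨_, h⟩ rfl rfl
    calc _ ≤ Nat.card T := Nat.card_le_card_of_injective (fun p => ⟨p.1, hsub p⟩) fun a b h =>
          Subtype.ext (Subtype.mk.inj h)
      _ = M := by simp [hTM]
      _ ≤ q := hMq.le
  obtain ⟨G, h1, h2, h3⟩ := P.exists_graph_fin (n := n) (by
    simp only [Fintype.card_fin, Fintype.card_coe, hSs]
    linarith)
  refine ⟨G, h1, h2, h3.trans ?_⟩
  simp only [Fintype.card_fin, Fintype.card_coe, hSs]
  linarith

lemma exists_remainder (m q : ℕ) (hq : 3 ≤ q) :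
    ∃ δ ≤ 1, ∃ s M, m + M = s * (q + 1) + δ ∧ M ≠ 1 ∧ M < q := by
  have h := Nat.div_add_mod m (q + 1)
  have hlt := Nat.mod_lt m (show 0 < q + 1 by omega)
  set r := m % (q + 1)
  set d := m / (q + 1)
  rw [Nat.mul_comm] at h
  rcases Nat.eq_zero_or_pos r with h0 | h0
  · exact ⟨0, by omega, d, 0, by omega, by omega, by omega⟩
  by_cases h1 : r = 1
  · exact ⟨1, le_rfl, d, 0, by omega, by omega, by omega⟩
  have hd : (d + 1) * (q + 1) = d * (q + 1) + (q + 1) := by ring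
  by_cases hr : r = q
  · exact ⟨1, le_rfl, d + 1, 2, by omega, by omega, by omega⟩
  · exact ⟨0, by omega, d + 1, q + 1 - r, by omega, by omega, by omega⟩

lemma exists_cube_root (n : ℕ) : ∃ w, n ≤ w ^ 3 ∧ ∀ x < w, x ^ 3 < n := by
  have h : ∃ w, n ≤ w ^ 3 := ⟨n, Nat.le_self_pow (by norm_num) n⟩
  classical
  exact ⟨Nat.find h, Nat.find_spec h, fun x hx => not_le.1 (Nat.find_min h hx)⟩

lemma exists_graph_of_large {C K : ℕ} (hC : 1 ≤ C) (hK : 4 ≤ K) {n : ℕ}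
    (hn : (5 + 4 * C + K * (2 * C + 1) ^ 2) ^ 3 < n) :
    ∃ w s q : ℕ, 1 ≤ w ∧ q = C * w ∧ K * (q + 1) ≤ s ∧ s * q ≤ n ∧
      ∃ G : SimpleGraph (Fin n), Ksat 3 G ∧ TwinFree G ∧
        G.edgeSet.ncard ≤ 6 * (s * q) + q * q + q + s * (w + (w + 1)) := by
  obtain ⟨w, hw, hmin⟩ := exists_cube_root n
  set A := 5 + 4 * C + K * (2 * C + 1) ^ 2 with hA
  have hAw : A < w := lt_of_pow_lt_pow_left₀ 3 (Nat.zero_le _) (hn.trans_le hw)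
  obtain ⟨x, rfl⟩ : ∃ x, w = x + 1 := ⟨w - 1, by omega⟩
  have hx := hmin x x.lt_succ_self
  have hAx : A ≤ x := by omega
  have hx1 : 1 ≤ x := by omega
  set q := C * (x + 1) with hq
  have hq2 : q ≤ 2 * C * x := by nlinarith
  have hqw : x + 1 ≤ q := Nat.le_mul_of_pos_left _ hC
  have hlarge : K * (q + 1) ^ 2 + (2 * q + 2 * (x + 1) + 1) ≤ x ^ 3 := by
    have h1 : q + 1 ≤ (2 * C + 1) * x := by nlinarith
    have h2 : K * (q + 1) ^ 2 ≤ K * ((2 * C + 1) * x) ^ 2 := by gcongr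
    have h3 : x ≤ x ^ 2 := Nat.le_self_pow (by norm_num) x
    have h4 : 2 * q + 2 * (x + 1) + 1 ≤ (5 + 4 * C) * x := by nlinarith
    calc _ ≤ K * ((2 * C + 1) * x) ^ 2 + (5 + 4 * C) * x ^ 2 :=
          add_le_add h2 (h4.trans (by gcongr))
      _ = A * x ^ 2 := by rw [hA]; ring
      _ ≤ x * x ^ 2 := by gcongr
      _ = x ^ 3 := by ring
  obtain ⟨m, hm⟩ : ∃ m, n = m + (1 + 2 * q + 2 * (x + 1)) :=
    ⟨n - (1 + 2 * q + 2 * (x + 1)), by omega⟩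
  obtain ⟨δ, hδ, s, M, hsM, hM1, hMq⟩ := exists_remainder m q (by omega)
  have hsK : K * (q + 1) ≤ s := by
    refine Nat.le_of_mul_le_mul_right (c := q + 1) ?_ (by omega)
    calc K * (q + 1) * (q + 1) = K * (q + 1) ^ 2 := by ring
      _ ≤ s * (q + 1) := by omega
  have hsn : s * q ≤ n := by
    have : s * q ≤ s * (q + 1) := Nat.mul_le_mul_left _ (by omega)
    omega
  have hsw : s ≤ (x + 1) * (x + 1) := by
    refine Nat.le_of_mul_le_mul_right (c := x + 1) ?_ (by omega)
    calc s * (x + 1) ≤ s * q := Nat.mul_le_mul_left _ hqw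
      _ ≤ (x + 1) ^ 3 := hsn.trans hw
      _ = _ := by ring
  have hs4 : 4 * (q + 1) ≤ s := (Nat.mul_le_mul_right _ hK).trans hsK
  obtain ⟨G, h1, h2, h3⟩ := exists_graph_of_params (q := q) (w := x + 1) (w' := x + 1 + δ)
    (s := s) (M := M) (n := n) (by omega) (by omega) (by omega) hM1 hMq (by omega)
    (hsw.trans (Nat.mul_le_mul_left _ (by omega))) (by omega)
  exact ⟨x + 1, s, q, by omega, rfl, hsK, hsn, G, h1, h2, h3.trans (by gcongr)⟩

lemma upper_bound {ε : ℝ} (hε : 0 < ε) : ∃ N : ℕ, ∀ n, N ≤ n →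
    ∃ G : SimpleGraph (Fin n), Ksat 3 G ∧ TwinFree G ∧
      (G.edgeSet.ncard : ℝ) ≤ ((6 : ℝ) + ε) * n := by
  obtain ⟨C, hC⟩ := exists_nat_ge (6 / ε)
  obtain ⟨K, hK⟩ := exists_nat_ge (2 / ε)
  rw [div_le_iff₀ hε] at hC hK
  have hC1 : 1 ≤ C := by
    by_contra h
    obtain rfl : C = 0 := by omega
    norm_num at hC
  refine ⟨(5 + 4 * C + max K 4 * (2 * C + 1) ^ 2) ^ 3 + 1, fun n hn => ?_⟩
  obtain ⟨w, s, q, hw, hq, hs, hsn, G, h1, h2, h3⟩ :=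
    exists_graph_of_large hC1 (le_max_right K 4) (Nat.lt_of_succ_le hn)
  refine ⟨G, h1, h2, ?_⟩
  have hs' : (K : ℝ) * (q + 1) ≤ s := by
    exact_mod_cast (Nat.mul_le_mul_right _ (le_max_left K 4)).trans hs
  have h3' : (G.edgeSet.ncard : ℝ) ≤ 6 * (s * q) + q * q + q + s * (w + (w + 1)) := by
    exact_mod_cast h3
  have hsn' : (s : ℝ) * q ≤ n := by exact_mod_cast hsn
  have hw' : (1 : ℝ) ≤ w := by exact_mod_cast hw
  have hq' : (q : ℝ) = C * w := by exact_mod_cast hq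
  have e1 : (q : ℝ) * q + q ≤ ε / 2 * (s * q) := by
    have : (q : ℝ) + 1 ≤ ε / 2 * s := by
      calc (q : ℝ) + 1 = 1 * (q + 1) := by ring
        _ ≤ (ε / 2 * K) * (q + 1) := by gcongr; linarith
        _ = ε / 2 * (K * (q + 1)) := by ring
        _ ≤ _ := by gcongr
    calc (q : ℝ) * q + q = (q + 1) * q := by ring
      _ ≤ (ε / 2 * s) * q := by gcongr
      _ = _ := by ring
  have e2 : (s : ℝ) * (w + (w + 1)) ≤ ε / 2 * (s * q) := by
    have : (w : ℝ) + (w + 1) ≤ ε / 2 * q := by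
      calc (w : ℝ) + (w + 1) ≤ 3 * w := by linarith
        _ ≤ (ε / 2 * C) * w := by gcongr; linarith
        _ = _ := by rw [hq']; ring
    calc (s : ℝ) * (w + (w + 1)) ≤ s * (ε / 2 * q) := by gcongr
      _ = _ := by ring
  calc _ ≤ (6 + ε) * ((s : ℝ) * q) := by linarith
    _ ≤ _ := by gcongr

end TwinFreeSat

/-- `(17/3)n + o(n) ≤ tsat(n, K_3) ≤ 6n + o(n)`. -/
theorem stmt2 (ε : ℝ) (hε : 0 < ε) :
    ∃ N : ℕ, ∀ n : ℕ, N ≤ n →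
      (∀ (V : Type) [Fintype V] (G : SimpleGraph V), Fintype.card V = n →
        Ksat 3 G → TwinFree G → ((17 : ℝ) / 3 - ε) * n ≤ (G.edgeSet.ncard : ℝ)) ∧
      (∃ G : SimpleGraph (Fin n), Ksat 3 G ∧ TwinFree G ∧
        (G.edgeSet.ncard : ℝ) ≤ ((6 : ℝ) + ε) * n) := by
  obtain ⟨N₁, h₁⟩ := TwinFreeSat.lower_bound hε
  obtain ⟨N₂, h₂⟩ := TwinFreeSat.upper_bound hε
  refine ⟨max N₁ N₂, fun n hn => ⟨?_, h₂ n ((le_max_right _ _).trans hn)⟩⟩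
  rintro V _ G rfl h3 h4
  exact h₁ V G ((le_max_left _ _).trans hn) h3 h4
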